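/- Let f : ℝ⁴ → ℂ be a Schwartz function of unit frequency, and let u(t,x) = e^{it√(−Δ)}f(x). Then for all exponents q, r ∈ [2,∞] satisfying 1/q + 3/(2r) ≤ 3/4 there is a constant C_{q,r} (independent of f) such that ‖u‖_{L^q_t L^r_x} ≤ C_{q,r} ‖f‖_{L²(ℝ⁴)}. In particular this includes the endpoint estimates ‖u‖_{L^∞_t L²_x} ≲ ‖f‖_{L²}, ‖u‖_{L²_t L^∞_x} ≲ ‖f‖_{L²}, and ‖u‖_{L²_t L⁶_x} ≲ ‖f‖_{L²}. -/

import Mathlib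

open MeasureTheory Complex
open scoped FourierTransform RealInnerProductSpace ENNReal

noncomputable section

/-- Four-dimensional Euclidean space. -/
abbrev Sp : Type := EuclideanSpace ℝ (Fin 4)

/-- The half-wave propagator `e^{it√(−Δ)}f(x) = ∫ e^{2πi(t|ξ| + x·ξ)} f̂(ξ) dξ`. -/
def halfWave (f : Sp → ℂ) (t : ℝ) (x : Sp) : ℂ :=
  ∫ ξ : Sp, Complex.exp (2 * Real.pi * Complex.I * ((t * ‖ξ‖ + ⟪x, ξ⟫ : ℝ) : ℂ)) * 𝓕 f ξ

/-- `f` has unit frequency: `f̂` is supported in the annulus `{1/2 ≤ |ξ| ≤ 2}`. -/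
def UnitFrequency (f : Sp → ℂ) : Prop :=
  ∀ ξ : Sp, 𝓕 f ξ ≠ 0 → 1/2 ≤ ‖ξ‖ ∧ ‖ξ‖ ≤ 2

/-- The mixed space-time norm `‖u‖_{L^q_t L^r_x}`. -/
def LqLr (q r : ℝ≥0∞) (u : ℝ → Sp → ℂ) : ℝ≥0∞ :=
  eLpNorm (fun t => (eLpNorm (u t) r volume).toReal) q volume

open Filter Topology Set in
/-- The one-dimensional subordination identity, as an antiderivative computation. -/
theorem integral_subordination {a b : ℝ} (ha : 0 < a) (hb : 0 < b) :
    ∫ u in Ioi (0 : ℝ), (a / √u) * Real.exp (-(a ^ 2 * u) - b ^ 2 / u)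
      = √Real.pi * Real.exp (-(2 * a * b)) := by
  set Φ : ℝ → ℝ := fun z => ∫ y in (0 : ℝ)..z, Real.exp (-1 * y ^ 2) with hΦ
  have hint : Integrable (fun y : ℝ => Real.exp (-1 * y ^ 2)) := integrable_exp_neg_mul_sq one_pos
  have hcont : Continuous (fun y : ℝ => Real.exp (-1 * y ^ 2)) := by fun_prop
  have hΦd (z : ℝ) : HasDerivAt Φ (Real.exp (-1 * z ^ 2)) z :=
    intervalIntegral.integral_hasDerivAt_right (hcont.intervalIntegrable _ _)
      hcont.stronglyMeasurable.stronglyMeasurableAtFilter hcont.continuousAt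
  have hΦtop : Tendsto Φ atTop (𝓝 (√Real.pi / 2)) := by
    have := intervalIntegral_tendsto_integral_Ioi 0 hint.integrableOn tendsto_id
    rw [integral_gaussian_Ioi] at this
    simpa [hΦ] using this
  have hΦodd (z : ℝ) : Φ (-z) = - Φ z := by
    have := intervalIntegral.integral_comp_neg (a := 0) (b := z)
      (fun y : ℝ => Real.exp (-1 * y ^ 2))
    simp only [neg_zero, even_two, Even.neg_pow] at this
    simp only [hΦ]
    rw [this, intervalIntegral.integral_symm]
  have hΦbot : Tendsto Φ atBot (𝓝 (-(√Real.pi / 2))) := by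
    have : Tendsto (fun z => - Φ (-z)) atBot (𝓝 (-(√Real.pi / 2))) :=
      (hΦtop.comp tendsto_neg_atBot_atTop).neg
    simpa [hΦodd] using this
  set E : ℝ → ℝ := fun u => Real.exp (-(2 * a * b)) * Φ (a * √u - b / √u)
    + Real.exp (2 * a * b) * Φ (a * √u + b / √u) with hE
  set ℓ : ℝ := Real.exp (-(2 * a * b)) * (-(√Real.pi / 2)) + Real.exp (2 * a * b) * (√Real.pi / 2)
  have hs0 : Tendsto (fun u : ℝ => √u) (𝓝[>] 0) (𝓝[>] 0) := by
    refine tendsto_nhdsWithin_iff.2 ⟨?_, ?_⟩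
    · have := Real.continuous_sqrt.tendsto 0
      rw [Real.sqrt_zero] at this
      exact this.mono_left nhdsWithin_le_nhds
    · filter_upwards [self_mem_nhdsWithin] with u hu
      exact Real.sqrt_pos.2 hu
  have hs0' : Tendsto (fun u : ℝ => a * √u) (𝓝[>] 0) (𝓝 0) := by
    simpa using (hs0.mono_right nhdsWithin_le_nhds).const_mul a
  have hd0 : Tendsto (fun u : ℝ => b / √u) (𝓝[>] 0) atTop := by
    simpa [div_eq_mul_inv] using (tendsto_inv_nhdsGT_zero.comp hs0).const_mul_atTop hb
  have hE0 : Tendsto E (𝓝[>] 0) (𝓝 ℓ) := by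
    refine ((hΦbot.comp ?_).const_mul _).add ((hΦtop.comp ?_).const_mul _)
    · simpa [sub_eq_add_neg] using hs0'.add_atBot (tendsto_neg_atTop_atBot.comp hd0)
    · exact hs0'.add_atTop hd0
  have hst : Tendsto (fun u : ℝ => a * √u) atTop atTop := Real.tendsto_sqrt_atTop.const_mul_atTop ha
  have hdt : Tendsto (fun u : ℝ => b / √u) atTop (𝓝 0) :=
    Real.tendsto_sqrt_atTop.const_div_atTop b
  have hEt : Tendsto E atTop (𝓝 (Real.exp (-(2 * a * b)) * (√Real.pi / 2)
      + Real.exp (2 * a * b) * (√Real.pi / 2))) := by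
    refine ((hΦtop.comp ?_).const_mul _).add ((hΦtop.comp ?_).const_mul _)
    · simpa [sub_eq_add_neg] using hst.atTop_add hdt.neg
    · exact hst.atTop_add hdt
  have hEd (u : ℝ) (hu : 0 < u) :
      HasDerivAt E ((a / √u) * Real.exp (-(a ^ 2 * u) - b ^ 2 / u)) u := by
    have hs : 0 < √u := Real.sqrt_pos.2 hu
    have hsq : √u ^ 2 = u := Real.sq_sqrt hu.le
    have h1 : HasDerivAt (fun u => √u) (1 / (2 * √u)) u := Real.hasDerivAt_sqrt hu.ne'
    have h2 : HasDerivAt (fun u => b / √u) (-(b * (1 / (2 * √u))) / √u ^ 2) u := by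
      simpa using (hasDerivAt_const u b).fun_div h1 hs.ne'
    have h3 := (((hΦd _).comp u ((h1.const_mul a).sub h2)).const_mul
      (Real.exp (-(2 * a * b)))).add
      (((hΦd _).comp u ((h1.const_mul a).add h2)).const_mul (Real.exp (2 * a * b)))
    refine HasDerivAt.congr_deriv h3 ?_
    have e1 : Real.exp (-1 * (a * √u - b / √u) ^ 2)
        = Real.exp (-(a ^ 2 * u) - b ^ 2 / u) * Real.exp (2 * a * b) := by
      rw [← Real.exp_add]; congr 1
      rw [sub_sq, mul_pow, div_pow, hsq]; field_simp; ring
    have e2 : Real.exp (-1 * (a * √u + b / √u) ^ 2)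
        = Real.exp (-(a ^ 2 * u) - b ^ 2 / u) * Real.exp (-(2 * a * b)) := by
      rw [← Real.exp_add]; congr 1
      rw [add_sq, mul_pow, div_pow, hsq]; field_simp; ring
    have e3 : Real.exp (-(2 * a * b)) * Real.exp (2 * a * b) = 1 := by
      rw [← Real.exp_add]; simp
    simp only [Pi.sub_apply, Pi.add_apply]
    rw [e1, e2]
    linear_combination ((a / √u) * Real.exp (-(a ^ 2 * u) - b ^ 2 / u)) * e3
  set E' := Function.update E 0 ℓ with hE'
  have key := integral_Ioi_of_hasDerivAt_of_nonneg (a := 0) (g := E')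
    (g' := fun u => (a / √u) * Real.exp (-(a ^ 2 * u) - b ^ 2 / u))
    (l := Real.exp (-(2 * a * b)) * (√Real.pi / 2) + Real.exp (2 * a * b) * (√Real.pi / 2))
    ?_ ?_ ?_ ?_
  · rw [key, hE', Function.update_self]
    simp only [ℓ]; ring
  · rw [hE', continuousWithinAt_update_same]
    simpa using hE0
  · intro u hu
    refine (hEd u hu).congr_of_eventuallyEq ?_
    filter_upwards [lt_mem_nhds hu] with v hv
    exact Function.update_of_ne hv.ne' _ _
  · intro u hu
    positivity
  · refine hEt.congr' ?_
    filter_upwards [eventually_gt_atTop 0] with v hv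
    exact (Function.update_of_ne hv.ne' _ _).symm

theorem integrable_pow_mul_exp_neg_norm (k : ℕ) {c : ℝ} (hc : 0 < c) :
    Integrable (fun ξ : Sp => ‖ξ‖ ^ k * Real.exp (-(c * ‖ξ‖))) := by
  have h := (integrable_one_add_norm (E := Sp) (μ := volume) (r := 5) (by simp; norm_num)).const_mul
    ((k + 5).factorial / c ^ (k + 5) * Real.exp c)
  refine h.mono' (by fun_prop) (Filter.Eventually.of_forall fun ξ => ?_)
  have hr := norm_nonneg ξ
  set r := ‖ξ‖
  have h1 := Real.pow_div_factorial_le_exp (c * (1 + r)) (by positivity) (k + 5)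
  rw [Real.norm_of_nonneg (by positivity), Real.rpow_neg (by positivity)]
  have h2 : r ^ k ≤ (1 + r) ^ k := by gcongr; linarith
  have h3 : Real.exp (c * (1 + r)) = Real.exp c / Real.exp (-(c * r)) := by
    rw [← Real.exp_sub]; ring_nf
  rw [h3, div_le_div_iff₀ (by positivity) (by positivity), mul_pow] at h1
  have h4 : (1 + r) ^ (5 : ℝ) = (1 + r) ^ 5 := by norm_cast
  rw [h4]
  calc r ^ k * Real.exp (-(c * r)) ≤ (1 + r) ^ k * Real.exp (-(c * r)) := by gcongr
    _ ≤ _ := by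
      rw [← div_eq_mul_inv, le_div_iff₀ (by positivity), div_mul_eq_mul_div,
        le_div_iff₀ (by positivity)]
      calc _ = c ^ (k + 5) * (1 + r) ^ (k + 5) * Real.exp (-(c * r)) := by ring
        _ ≤ _ := h1
        _ = _ := by ring

theorem integrable_exp_neg_norm {c : ℝ} (hc : 0 < c) :
    Integrable (fun ξ : Sp => Real.exp (-(c * ‖ξ‖))) := by
  simpa using integrable_pow_mul_exp_neg_norm 0 hc

/-- The Fourier transform of `exp (-2πz|ξ|)`, a Poisson kernel at the complex height `z`. -/
def coneKernel (z : ℂ) (x : Sp) : ℂ :=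
  ∫ ξ : Sp, cexp (-(2 * Real.pi * z * ‖ξ‖) + 2 * Real.pi * I * ⟪x, ξ⟫)

open Set in
theorem coneKernel_ofReal {a : ℝ} (ha : 0 < a) (x : Sp) :
    coneKernel a x = ((Real.Gamma (5 / 2) / (√Real.pi * Real.pi ^ 2) * a *
      (a ^ 2 + ‖x‖ ^ 2) ^ (-(5 / 2) : ℝ) : ℝ) : ℂ) := by
  have hπ := Real.pi_pos
  set F : Sp → ℝ → ℂ := fun ξ u => ((a / √u * Real.exp (-(a ^ 2 * u)) : ℝ) : ℂ) *
    cexp (-((Real.pi ^ 2 / u : ℝ) : ℂ) * ‖ξ‖ ^ 2 + 2 * Real.pi * I * ⟪x, ξ⟫) with hF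
  have hnorm (ξ : Sp) (u : ℝ) : ‖F ξ u‖ =
      (a / √u) * Real.exp (-(a ^ 2 * u) - (Real.pi * ‖ξ‖) ^ 2 / u) := by
    rw [hF, norm_mul, Complex.norm_real, Complex.norm_exp, Real.norm_of_nonneg (by positivity),
      mul_assoc, ← Real.exp_add]
    congr 2
    simp only [add_re, mul_re, mul_im, neg_re, neg_im, ofReal_re, ofReal_im, I_re, I_im,
      ← ofReal_pow, re_ofNat, im_ofNat]
    ring
  have hFe (ξ : Sp) (u : ℝ) : F ξ u = ((‖F ξ u‖ : ℝ) : ℂ) * cexp (2 * Real.pi * I * ⟪x, ξ⟫) := by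
    rw [hnorm, hF]
    simp only
    rw [Complex.exp_add, ← mul_assoc, sub_eq_add_neg, Real.exp_add]
    push_cast
    rw [← mul_assoc]
    congr 3
    ring
  have hne : ∀ᵐ ξ : Sp, ξ ≠ 0 := by
    simp [ae_iff]
  have hsub (ξ : Sp) (hξ : ξ ≠ 0) : ∫ u in Ioi (0 : ℝ), ‖F ξ u‖ =
      √Real.pi * Real.exp (-(2 * Real.pi * a * ‖ξ‖)) := by
    simp_rw [hnorm]
    rw [integral_subordination ha (mul_pos hπ (norm_pos_iff.2 hξ))]
    congr 3; ring
  have hmeas : Measurable (Function.uncurry F) := by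
    simp only [hF, Function.uncurry_def]
    fun_prop
  have hint : Integrable (Function.uncurry F) (volume.prod (volume.restrict (Ioi 0))) := by
    rw [integrable_prod_iff hmeas.aestronglyMeasurable]
    constructor
    · filter_upwards [hne] with ξ hξ
      have : Integrable (fun u => ‖F ξ u‖) (volume.restrict (Ioi 0)) := by
        refine not_imp_comm.1 integral_undef ?_
        rw [hsub ξ hξ]; positivity
      refine (integrable_norm_iff ?_).1 this
      exact (hmeas.comp measurable_prodMk_left).aestronglyMeasurable
    · have := (integrable_exp_neg_norm (c := 2 * Real.pi * a) (by positivity)).const_mul √Real.pi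
      refine this.congr ?_
      filter_upwards [hne] with ξ hξ
      exact (hsub ξ hξ).symm
  have h1 : coneKernel a x = (√Real.pi : ℂ)⁻¹ * ∫ ξ, ∫ u in Ioi (0 : ℝ), F ξ u := by
    rw [coneKernel, ← integral_const_mul]
    refine integral_congr_ae ?_
    filter_upwards [hne] with ξ hξ
    rw [integral_congr_ae (Filter.Eventually.of_forall (hFe ξ)), integral_mul_const,
      integral_complex_ofReal, hsub ξ hξ, Complex.exp_add]
    push_cast
    rw [← mul_assoc, ← mul_assoc, inv_mul_cancel₀ (by simp only [ne_eq, ofReal_eq_zero]; positivity), one_mul]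
  have hinner (u : ℝ) (hu : 0 < u) : ∫ ξ, F ξ u = ((a / Real.pi ^ 2 *
      (u ^ ((5 / 2 : ℝ) - 1) * Real.exp (-((a ^ 2 + ‖x‖ ^ 2) * u))) : ℝ) : ℂ) := by
    simp only [hF]
    rw [integral_const_mul, GaussianFourier.integral_cexp_neg_mul_sq_norm_add
      (by rw [ofReal_re]; positivity)]
    have e1 : ((Module.finrank ℝ Sp : ℕ) : ℂ) / 2 = (2 : ℕ) := by
      simp; norm_num
    have e2 : (2 * Real.pi * I) ^ 2 * (‖x‖ : ℂ) ^ 2 / (4 * ((Real.pi ^ 2 / u : ℝ) : ℂ))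
        = ((-(‖x‖ ^ 2 * u) : ℝ) : ℂ) := by
      have : (Real.pi : ℂ) ≠ 0 := by simp [hπ.ne']
      have : (u : ℂ) ≠ 0 := by simp [hu.ne']
      push_cast
      rw [mul_pow, I_sq]
      field_simp
      ring
    rw [e1, e2, cpow_natCast, ← ofReal_exp, ← ofReal_div, ← ofReal_pow, ← ofReal_mul, ← ofReal_mul]
    congr 1
    have e3 : u ^ ((5 / 2 : ℝ) - 1) = u ^ 2 / √u := by
      rw [Real.sqrt_eq_rpow, ← Real.rpow_natCast, ← Real.rpow_sub hu]; norm_num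
    rw [e3, add_mul, neg_add, Real.exp_add]
    field_simp
  rw [h1, integral_integral_swap hint, setIntegral_congr_fun measurableSet_Ioi hinner,
    integral_complex_ofReal, integral_const_mul,
    Real.integral_rpow_mul_exp_neg_mul_Ioi (by norm_num) (by positivity), ← ofReal_inv,
    ← ofReal_mul]
  congr 1
  rw [one_div, Real.inv_rpow (by positivity), ← Real.rpow_neg (by positivity)]
  field_simp

theorem norm_coneKernel_integrand (z : ℂ) (x ξ : Sp) :
    ‖cexp (-(2 * Real.pi * z * ‖ξ‖) + 2 * Real.pi * I * ⟪x, ξ⟫)‖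
      = Real.exp (-(2 * Real.pi * z.re * ‖ξ‖)) := by
  rw [Complex.norm_exp]
  congr 1
  simp

theorem norm_coneKernel_le {z : ℂ} (x : Sp) :
    ‖coneKernel z x‖ ≤ ∫ ξ : Sp, Real.exp (-(2 * Real.pi * z.re * ‖ξ‖)) :=
  (norm_integral_le_integral_norm _).trans_eq (by simp_rw [norm_coneKernel_integrand])

theorem differentiableAt_coneKernel {z : ℂ} (hz : 0 < z.re) (x : Sp) :
    DifferentiableAt ℂ (fun z => coneKernel z x) z := by
  have hπ := Real.pi_pos
  have hre : ∀ w ∈ Metric.ball z (z.re / 2), z.re / 2 ≤ w.re := by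
    intro w hw
    rw [Metric.mem_ball, dist_eq_norm] at hw
    have := (abs_le.1 ((Complex.abs_re_le_norm (w - z)).trans hw.le)).1
    rw [sub_re] at this
    linarith
  refine (hasDerivAt_integral_of_dominated_loc_of_deriv_le (𝕜 := ℂ)
    (F := fun w (ξ : Sp) => cexp (-(2 * Real.pi * w * ‖ξ‖) + 2 * Real.pi * I * ⟪x, ξ⟫))
    (F' := fun w (ξ : Sp) => cexp (-(2 * Real.pi * w * ‖ξ‖) + 2 * Real.pi * I * ⟪x, ξ⟫)
      * (-(2 * Real.pi * ‖ξ‖)))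
    (bound := fun ξ => 2 * Real.pi * (‖ξ‖ ^ 1 * Real.exp (-(Real.pi * z.re * ‖ξ‖))))
    (s := Metric.ball z (z.re / 2)) (x₀ := z) (Metric.ball_mem_nhds z (by positivity))
    ?_ ?_ ?_ ?_ ?_ ?_).2.differentiableAt
  · exact Filter.Eventually.of_forall fun w => by fun_prop
  · refine (integrable_exp_neg_norm (c := 2 * Real.pi * z.re) (by positivity)).mono'
      (by fun_prop) (Filter.Eventually.of_forall fun ξ => ?_)
    rw [norm_coneKernel_integrand]
  · fun_prop
  · refine Filter.Eventually.of_forall fun ξ w hw => ?_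
    rw [norm_mul, norm_coneKernel_integrand, norm_neg, norm_mul, norm_mul, norm_real, norm_real,
      norm_norm, Real.norm_of_nonneg hπ.le, Complex.norm_ofNat, mul_comm, mul_assoc (2 * Real.pi),
      pow_one]
    gcongr 2 * Real.pi * (‖ξ‖ * Real.exp (-?_))
    have := hre w hw
    have := mul_le_mul_of_nonneg_left this (by positivity : 0 ≤ 2 * Real.pi * ‖ξ‖)
    nlinarith
  · exact (integrable_pow_mul_exp_neg_norm 1 (by positivity)).const_mul _
  · refine Filter.Eventually.of_forall fun ξ w hw => ?_
    have h1 : HasDerivAt (fun w : ℂ => -(2 * Real.pi * w * ‖ξ‖) + 2 * Real.pi * I * ⟪x, ξ⟫)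
        (-(2 * Real.pi * ‖ξ‖)) w := by
      have := ((((hasDerivAt_id w).const_mul (2 * Real.pi : ℂ)).mul_const (‖ξ‖ : ℂ)).neg).add_const
        (2 * Real.pi * I * ⟪x, ξ⟫ : ℂ)
      simpa using this
    exact h1.cexp

theorem sq_add_mem_slitPlane {z : ℂ} (hz : 0 < z.re) (r : ℝ) :
    z ^ 2 + (r : ℂ) ^ 2 ∈ slitPlane := by
  rw [Complex.mem_slitPlane_iff]
  have h1 : (z ^ 2 + (r : ℂ) ^ 2).re = z.re ^ 2 - z.im ^ 2 + r ^ 2 := by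
    rw [← ofReal_pow, add_re, ofReal_re, sq, mul_re]; ring
  have h2 : (z ^ 2 + (r : ℂ) ^ 2).im = 2 * z.re * z.im := by
    rw [← ofReal_pow, add_im, ofReal_im, sq, mul_im]; ring
  rw [h1, h2]
  by_cases h : z.im = 0
  · left; rw [h]; nlinarith [sq_nonneg r, mul_pos hz hz]
  · right; simp [hz.ne', h]

def coneConst : ℝ := Real.Gamma (5 / 2) / (√Real.pi * Real.pi ^ 2)

theorem coneConst_pos : 0 < coneConst := by
  have := Real.pi_pos
  have := Real.Gamma_pos_of_pos (s := 5 / 2) (by norm_num)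
  unfold coneConst
  positivity

theorem coneKernel_eq {z : ℂ} (hz : 0 < z.re) (x : Sp) :
    coneKernel z x = coneConst * z * (z ^ 2 + (‖x‖ : ℂ) ^ 2) ^ ((-(5 / 2) : ℝ) : ℂ) := by
  set U : Set ℂ := {z | 0 < z.re} with hU
  have hUo : IsOpen U := isOpen_lt continuous_const Complex.continuous_re
  have hUc : IsPreconnected U := (convex_halfSpace_re_gt 0).isPreconnected
  have hf : AnalyticOnNhd ℂ (fun z => coneKernel z x) U :=
    DifferentiableOn.analyticOnNhd
      (fun w hw => (differentiableAt_coneKernel hw x).differentiableWithinAt) hUo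
  have hg : AnalyticOnNhd ℂ (fun z : ℂ => coneConst * z * (z ^ 2 + (‖x‖ : ℂ) ^ 2) ^
      ((-(5 / 2) : ℝ) : ℂ)) U := by
    refine DifferentiableOn.analyticOnNhd (fun w hw => ?_) hUo
    refine DifferentiableAt.differentiableWithinAt ?_
    refine (by fun_prop : DifferentiableAt ℂ (fun z : ℂ => coneConst * z) w).mul ?_
    exact DifferentiableAt.cpow (by fun_prop) (by fun_prop) (sq_add_mem_slitPlane hw _)
  refine hf.eqOn_of_preconnected_of_frequently_eq hg hUc (z₀ := 1) (by simp [hU]) ?_ hz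
  have ht : Filter.Tendsto (fun n : ℕ => ((1 + 1 / ((n : ℝ) + 1) : ℝ) : ℂ)) Filter.atTop
      (nhdsWithin 1 {1}ᶜ) := by
    refine tendsto_nhdsWithin_iff.2 ⟨?_, Filter.Eventually.of_forall fun n => ?_⟩
    · have := (tendsto_one_div_add_atTop_nhds_zero_nat (𝕜 := ℝ)).const_add 1
      rw [add_zero] at this
      have := (Complex.continuous_ofReal.tendsto 1).comp this
      rwa [ofReal_one] at this
    · have h : (0 : ℝ) < 1 / ((n : ℝ) + 1) := by positivity
      rw [Set.mem_compl_singleton_iff, ← ofReal_one, Ne, ofReal_inj]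
      linarith
  refine ht.frequently (Filter.Eventually.frequently (Filter.Eventually.of_forall fun n => ?_))
  have h : (0 : ℝ) < 1 + 1 / ((n : ℝ) + 1) := by positivity
  rw [coneKernel_ofReal h, coneConst, ofReal_mul, ofReal_mul, ofReal_cpow (by positivity)]
  push_cast
  rfl

/-- The dispersive estimate for the half-wave group regularised by `exp (-2π√(-Δ))`. -/
theorem norm_coneKernel_dispersive {t : ℝ} (ht : t ≠ 0) (x : Sp) :
    ‖coneKernel (1 - t * I) x‖ ≤ coneConst * |t| ^ (-(3 / 2) : ℝ) := by
  have hre : (1 - t * I : ℂ).re = 1 := by simp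
  have hc := coneConst_pos
  have ht' : 0 < |t| := abs_pos.2 ht
  rcases le_total |t| 1 with h | h
  · have h0 := coneKernel_ofReal one_pos (0 : Sp)
    rw [coneKernel] at h0
    have h1 := norm_coneKernel_le (z := 1 - t * I) x
    rw [hre] at h1
    have h2 : ((∫ ξ : Sp, Real.exp (-(2 * Real.pi * 1 * ‖ξ‖)) : ℝ) : ℂ) = coneConst := by
      rw [← integral_complex_ofReal]
      have h3 : ∀ ξ : Sp, ((Real.exp (-(2 * Real.pi * 1 * ‖ξ‖)) : ℝ) : ℂ)
          = cexp (-(2 * Real.pi * (1 : ℝ) * ‖ξ‖) + 2 * Real.pi * I * ⟪(0 : Sp), ξ⟫) := by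
        intro ξ; push_cast; simp
      simp_rw [h3]
      rw [h0]
      simp [coneConst]
    rw [ofReal_inj.1 h2] at h1
    refine h1.trans (le_mul_of_one_le_right hc.le ?_)
    exact Real.one_le_rpow_of_pos_of_le_one_of_nonpos ht' h (by norm_num)
  · rw [coneKernel_eq (by rw [hre]; exact one_pos), norm_mul, norm_mul, norm_real,
      Real.norm_of_nonneg hc.le, norm_cpow_real, mul_assoc]
    gcongr
    have h1 : ‖(1 - t * I : ℂ)‖ ≤ 2 * |t| := by
      calc _ ≤ ‖(1 : ℂ)‖ + ‖(t * I : ℂ)‖ := norm_sub_le _ _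
        _ = 1 + |t| := by simp
        _ ≤ _ := by linarith
    have h2 : |t| ≤ ‖(1 - t * I : ℂ) ^ 2 + (‖x‖ : ℂ) ^ 2‖ / 2 := by
      have : ((1 - t * I : ℂ) ^ 2 + (‖x‖ : ℂ) ^ 2).im = -2 * t := by
        rw [← ofReal_pow, add_im, ofReal_im, sq, mul_im]; simp; ring
      have h3 := Complex.abs_im_le_norm ((1 - t * I : ℂ) ^ 2 + (‖x‖ : ℂ) ^ 2)
      rw [this, abs_mul] at h3
      norm_num at h3
      linarith
    calc _ ≤ (2 * |t|) * (2 * |t|) ^ (-(5 / 2) : ℝ) := by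
          refine mul_le_mul h1 ?_ (by positivity) (by positivity)
          exact Real.rpow_le_rpow_of_nonpos (by positivity) (by linarith) (by norm_num)
      _ = (2 * |t|) ^ (-(3 / 2) : ℝ) := by
          rw [← Real.rpow_one_add' (by positivity) (by norm_num)]; norm_num
      _ ≤ _ := Real.rpow_le_rpow_of_nonpos (by positivity) (by linarith) (by norm_num)

theorem integrable_norm_coneKernel_one : Integrable (fun x : Sp => ‖coneKernel 1 x‖) := by
  have h : ∀ x : Sp, ‖coneKernel 1 x‖ = coneConst * (1 + ‖x‖ ^ 2) ^ (-(5 : ℝ) / 2) := by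
    intro x
    have := coneKernel_ofReal one_pos x
    rw [ofReal_one] at this
    rw [this, norm_real, Real.norm_of_nonneg]
    · rw [coneConst]; norm_num
    · have := coneConst_pos
      rw [coneConst] at this
      positivity
  simp_rw [h]
  exact (integrable_rpow_neg_one_add_norm_sq (E := Sp) (r := 5) (by simp; norm_num)).const_mul _

section strichartz

open ComplexConjugate NNReal

theorem enorm_integral_conj_mul_le_sqrt {Ξ : Type*} [MeasurableSpace Ξ] {ν : Measure Ξ}
    {f g : Ξ → ℂ} (hf : Measurable f) (hg : Measurable g) :
    ‖∫ ξ, conj (f ξ) * g ξ ∂ν‖ₑ ≤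
      (∫⁻ ξ, ‖f ξ‖ₑ ^ 2 ∂ν) ^ (1 / 2 : ℝ) * (∫⁻ ξ, ‖g ξ‖ₑ ^ 2 ∂ν) ^ (1 / 2 : ℝ) := by
  refine (enorm_integral_le_lintegral_enorm _).trans ?_
  have := ENNReal.lintegral_mul_le_Lp_mul_Lq ν Real.HolderConjugate.two_two
    hf.enorm.aemeasurable hg.enorm.aemeasurable
  simpa [enorm_mul] using this

theorem lintegral_enorm_sq_eq {Ξ : Type*} [MeasurableSpace Ξ] {ν : Measure Ξ}
    {f : Ξ → ℂ} (hf : MemLp f 2 ν) :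
    ∫⁻ ξ, ‖f ξ‖ₑ ^ 2 ∂ν = ‖∫ ξ, conj (f ξ) * f ξ ∂ν‖ₑ := by
  have h1 : ∀ ξ, conj (f ξ) * f ξ = ((‖f ξ‖ ^ 2 : ℝ) : ℂ) := by
    intro ξ; rw [mul_comm, mul_conj, normSq_eq_norm_sq]
  simp_rw [h1]
  rw [integral_complex_ofReal, ← ofReal_norm, norm_real,
    Real.norm_of_nonneg (by positivity), ofReal_integral_eq_lintegral_ofReal]
  · simp_rw [ENNReal.ofReal_pow (norm_nonneg _), ofReal_norm]
  · simpa using hf.integrable_norm_pow (by norm_num)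
  · exact Filter.Eventually.of_forall fun ξ => by positivity

/-- Fubini for sesquilinear pairings of superpositions. -/
theorem enorm_integral_conj_mul_le_lintegral {X Y Ξ : Type*} [MeasurableSpace X]
    [MeasurableSpace Y] [MeasurableSpace Ξ] {μ : Measure X} {μ' : Measure Y} {ν : Measure Ξ}
    [SFinite μ] [SFinite μ'] [IsFiniteMeasure ν] {a : X → Ξ → ℂ} {b : Y → Ξ → ℂ}
    (ha : Measurable (Function.uncurry a)) (hb : Measurable (Function.uncurry b))
    {A : X → ℝ} {B : Y → ℝ} (hA : Integrable A μ) (hB : Integrable B μ')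
    (haA : ∀ x ξ, ‖a x ξ‖ ≤ A x) (hbB : ∀ y ξ, ‖b y ξ‖ ≤ B y) :
    ‖∫ ξ, conj (∫ x, a x ξ ∂μ) * (∫ y, b y ξ ∂μ') ∂ν‖ₑ ≤
      ∫⁻ x, ∫⁻ y, ‖∫ ξ, conj (a x ξ) * b y ξ ∂ν‖ₑ ∂μ' ∂μ := by
  have hm : Measurable (fun p : Ξ × (X × Y) => conj (a p.2.1 p.1) * b p.2.2 p.1) := by
    have h1 : Measurable (fun p : Ξ × (X × Y) => a p.2.1 p.1) :=
      ha.comp (f := fun p : Ξ × (X × Y) => (p.2.1, p.1)) (by fun_prop)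
    have h2 : Measurable (fun p : Ξ × (X × Y) => b p.2.2 p.1) :=
      hb.comp (f := fun p : Ξ × (X × Y) => (p.2.2, p.1)) (by fun_prop)
    exact (continuous_conj.measurable.comp h1).mul h2
  have hint : Integrable (Function.uncurry fun (ξ : Ξ) (p : X × Y) => conj (a p.1 ξ) * b p.2 ξ)
      (ν.prod (μ.prod μ')) := by
    have h1 : Integrable (fun p : X × Y => A p.1 * B p.2) (μ.prod μ') := hA.mul_prod hB
    have h2 : Integrable (fun p : Ξ × (X × Y) => A p.2.1 * B p.2.2) (ν.prod (μ.prod μ')) :=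
      h1.comp_snd ν
    refine h2.mono' hm.aestronglyMeasurable (Filter.Eventually.of_forall fun p => ?_)
    simp only [Function.uncurry, norm_mul, RCLike.norm_conj]
    exact mul_le_mul (haA _ _) (hbB _ _) (norm_nonneg _) ((norm_nonneg _).trans (haA p.2.1 p.1))
  have hsw : Integrable (fun p : X × Y => ∫ ξ, conj (a p.1 ξ) * b p.2 ξ ∂ν) (μ.prod μ') :=
    hint.swap.integral_prod_left
  have key : ∫ ξ, conj (∫ x, a x ξ ∂μ) * (∫ y, b y ξ ∂μ') ∂ν =
      ∫ x, ∫ y, ∫ ξ, conj (a x ξ) * b y ξ ∂ν ∂μ' ∂μ := by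
    rw [← integral_prod (fun p : X × Y => ∫ ξ, conj (a p.1 ξ) * b p.2 ξ ∂ν) hsw,
      ← integral_integral_swap hint]
    congr with ξ
    rw [← integral_conj, ← integral_prod_mul]
  rw [key]
  refine (enorm_integral_le_lintegral_enorm _).trans ?_
  exact lintegral_mono fun x => enorm_integral_le_lintegral_enorm _

theorem mul_le_sq_add_sq_ennreal (a b : ℝ≥0∞) : a * b ≤ a ^ 2 + b ^ 2 := by
  rcases le_total a b with h | h
  · calc a * b ≤ b * b := by gcongr
      _ = b ^ 2 := (sq b).symm
      _ ≤ _ := le_add_self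
  · calc a * b ≤ a * a := by gcongr
      _ = a ^ 2 := (sq a).symm
      _ ≤ _ := le_self_add

/-- Schur's test for convolution kernels. -/
theorem lintegral_lintegral_kernel_le {E : Type*} [MeasurableSpace E] [AddCommGroup E]
    [MeasurableAdd₂ E] [MeasurableNeg E] {μ : Measure E} [SFinite μ] [μ.IsAddLeftInvariant]
    [μ.IsNegInvariant] {κ : E → ℝ≥0∞} (hκ : Measurable κ)
    {c d : E → ℝ≥0∞} (hc : Measurable c) (hd : Measurable d) :
    ∫⁻ t, ∫⁻ s, κ (t - s) * (c t * d s) ∂μ ∂μ ≤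
      (∫⁻ x, κ x ∂μ) * (∫⁻ t, c t ^ 2 ∂μ + ∫⁻ s, d s ^ 2 ∂μ) := by
  have hκ2 : Measurable (fun p : E × E => κ (p.1 - p.2)) :=
    hκ.comp (by simp_rw [sub_eq_add_neg]; fun_prop)
  calc _ ≤ ∫⁻ t, ∫⁻ s, (κ (t - s) * c t ^ 2 + κ (t - s) * d s ^ 2) ∂μ ∂μ := by
        gcongr with t s
        rw [← mul_add]
        gcongr
        exact mul_le_sq_add_sq_ennreal _ _
    _ = ∫⁻ t, ∫⁻ s, κ (t - s) * c t ^ 2 ∂μ ∂μ + ∫⁻ t, ∫⁻ s, κ (t - s) * d s ^ 2 ∂μ ∂μ := by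
        rw [← lintegral_add_left]
        · refine lintegral_congr fun t => lintegral_add_left ?_ _
          exact (hκ2.comp measurable_prodMk_left).mul_const _
        · exact (hκ2.mul ((hc.comp measurable_fst).pow_const 2)).lintegral_prod_right'
    _ = _ := by
        rw [mul_add]
        congr 1
        · rw [← lintegral_const_mul _ (hc.pow_const 2)]
          refine lintegral_congr fun t => ?_
          rw [lintegral_mul_const _ (show Measurable fun s => κ (t - s) from
            hκ2.comp measurable_prodMk_left),
            lintegral_sub_left_eq_self κ t]
        · rw [lintegral_lintegral_swap
            (hκ2.mul ((hd.comp measurable_snd).pow_const 2)).aemeasurable,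
            ← lintegral_const_mul _ (hd.pow_const 2)]
          refine lintegral_congr fun s => ?_
          rw [lintegral_mul_const _ (show Measurable fun t => κ (t - s) from
            hκ2.comp measurable_prodMk_right),
            lintegral_sub_right_eq_self κ s]

/-- The finite measure `exp (-2π|ξ|) dξ` on frequency space. -/
def freqMeasure : Measure Sp :=
  volume.withDensity fun ξ => ENNReal.ofReal (Real.exp (-(2 * Real.pi * ‖ξ‖)))

instance : IsFiniteMeasure freqMeasure :=
  isFiniteMeasure_withDensity_ofReal
    (integrable_exp_neg_norm (c := 2 * Real.pi) (by positivity)).hasFiniteIntegral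

/-- The space-time character `exp (-2πi(t|ξ| + x·ξ))`. -/
def waveChar (t : ℝ) (x ξ : Sp) : ℂ :=
  cexp (-(2 * Real.pi * Complex.I * ((t * ‖ξ‖ + ⟪x, ξ⟫ : ℝ) : ℂ)))

theorem continuous_waveChar : Continuous fun p : ℝ × Sp × Sp => waveChar p.1 p.2.1 p.2.2 := by
  unfold waveChar; fun_prop

@[simp]
theorem norm_waveChar (t : ℝ) (x ξ : Sp) : ‖waveChar t x ξ‖ = 1 := by
  have : -(2 * Real.pi * Complex.I * ((t * ‖ξ‖ + ⟪x, ξ⟫ : ℝ) : ℂ))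
      = ((-(2 * Real.pi * (t * ‖ξ‖ + ⟪x, ξ⟫)) : ℝ) : ℂ) * I := by push_cast; ring
  rw [waveChar, this, norm_exp_ofReal_mul_I]

theorem integral_conj_waveChar_mul (t s : ℝ) (x y : Sp) :
    ∫ ξ, conj (waveChar t x ξ) * waveChar s y ξ ∂freqMeasure
      = coneKernel (1 - ((t - s : ℝ) : ℂ) * I) (x - y) := by
  rw [freqMeasure, integral_withDensity_eq_integral_toReal_smul (by fun_prop) (by simp), coneKernel]
  congr with ξ
  rw [ENNReal.toReal_ofReal (by positivity), waveChar, waveChar, ← Complex.exp_conj,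
    ← Complex.exp_add, real_smul, ofReal_exp, ← Complex.exp_add]
  congr 1
  simp only [map_neg, map_mul, conj_ofReal, conj_I, map_ofNat, inner_sub_left]
  push_cast
  ring

/-- Adjoint of the half-wave propagator at time `t`, on the frequency side. -/
def sliceTransform (t : ℝ) (φ : Sp → ℂ) (ξ : Sp) : ℂ := ∫ x, φ x * waveChar t x ξ

theorem norm_sliceTransform_le (t : ℝ) (φ : Sp → ℂ) (ξ : Sp) :
    ‖sliceTransform t φ ξ‖ ≤ ∫ x, ‖φ x‖ :=
  (norm_integral_le_integral_norm _).trans_eq (by simp)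

theorem measurable_uncurry_sliceTransform {F : ℝ → Sp → ℂ} (hF : Measurable (Function.uncurry F)) :
    Measurable (Function.uncurry fun t ξ => sliceTransform t (F t) ξ) := by
  have h : Measurable (fun p : (ℝ × Sp) × Sp => F p.1.1 p.2 * waveChar p.1.1 p.2 p.1.2) := by
    refine (hF.comp (f := fun p : (ℝ × Sp) × Sp => (p.1.1, p.2)) (by fun_prop)).mul ?_
    exact (continuous_waveChar.comp (f := fun p : (ℝ × Sp) × Sp => (p.1.1, p.2, p.1.2))
      (by fun_prop)).measurable
  exact (h.stronglyMeasurable.integral_prod_right').measurable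

theorem measurable_sliceTransform {φ : Sp → ℂ} (hφ : Measurable φ) (t : ℝ) :
    Measurable (sliceTransform t φ) := by
  have h : Measurable (fun p : Sp × Sp => φ p.2 * waveChar t p.2 p.1) := by
    refine (hφ.comp measurable_snd).mul ?_
    exact (continuous_waveChar.comp (f := fun p : Sp × Sp => (t, p.2, p.1))
      (by fun_prop)).measurable
  exact (h.stronglyMeasurable.integral_prod_right').measurable

theorem enorm_integral_conj_sliceTransform_mul_le {φ ψ : Sp → ℂ} (hφm : Measurable φ)
    (hψm : Measurable ψ) (hφ : Integrable φ) (hψ : Integrable ψ) (t s : ℝ) :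
    ‖∫ ξ, conj (sliceTransform t φ ξ) * sliceTransform s ψ ξ ∂freqMeasure‖ₑ ≤
      ∫⁻ x, ∫⁻ y, ‖coneKernel (1 - ((t - s : ℝ) : ℂ) * I) (x - y)‖ₑ * (‖φ x‖ₑ * ‖ψ y‖ₑ) := by
  have hw (t : ℝ) : Measurable (fun p : Sp × Sp => waveChar t p.1 p.2) :=
    (continuous_waveChar.comp (f := fun p : Sp × Sp => (t, p.1, p.2)) (by fun_prop)).measurable
  refine (enorm_integral_conj_mul_le_lintegral (μ := volume) (μ' := volume) (ν := freqMeasure)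
    (a := fun x ξ => φ x * waveChar t x ξ) (b := fun y ξ => ψ y * waveChar s y ξ)
    ((hφm.comp measurable_fst).mul (hw t)) ((hψm.comp measurable_fst).mul (hw s))
    hφ.norm hψ.norm (by simp) (by simp)).trans_eq ?_
  refine lintegral_congr fun x => lintegral_congr fun y => ?_
  have h (ξ : Sp) : conj (φ x * waveChar t x ξ) * (ψ y * waveChar s y ξ) =
      conj (φ x) * ψ y * (conj (waveChar t x ξ) * waveChar s y ξ) := by
    rw [map_mul]; ring
  simp_rw [h]
  rw [integral_const_mul, integral_conj_waveChar_mul, enorm_mul, enorm_mul, mul_comm,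
    RCLike.enorm_conj]

theorem measurable_coneKernel (z : ℂ) : Measurable (coneKernel z) := by
  refine StronglyMeasurable.measurable ?_
  refine StronglyMeasurable.integral_prod_right'
    (f := fun p : Sp × Sp => cexp (-(2 * Real.pi * z * ‖p.2‖) + 2 * Real.pi * I * ⟪p.1, p.2⟫)) ?_
  exact Continuous.stronglyMeasurable (by fun_prop)

theorem enorm_integral_conj_sliceTransform_mul_le_dispersive {φ ψ : Sp → ℂ} (hφm : Measurable φ)
    (hψm : Measurable ψ) (hφ : Integrable φ) (hψ : Integrable ψ) (t s : ℝ) (hts : t ≠ s) :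
    ‖∫ ξ, conj (sliceTransform t φ ξ) * sliceTransform s ψ ξ ∂freqMeasure‖ₑ ≤
      ENNReal.ofReal coneConst * ENNReal.ofReal |t - s| ^ (-(3 / 2) : ℝ) *
        ((∫⁻ x, ‖φ x‖ₑ) * ∫⁻ y, ‖ψ y‖ₑ) := by
  refine (enorm_integral_conj_sliceTransform_mul_le hφm hψm hφ hψ t s).trans ?_
  have hK (x : Sp) : ‖coneKernel (1 - ((t - s : ℝ) : ℂ) * I) x‖ₑ ≤
      ENNReal.ofReal coneConst * ENNReal.ofReal |t - s| ^ (-(3 / 2) : ℝ) := by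
    rw [ENNReal.ofReal_rpow_of_pos (abs_pos.2 (sub_ne_zero.2 hts)),
      ← ENNReal.ofReal_mul coneConst_pos.le, ← ofReal_norm]
    exact ENNReal.ofReal_le_ofReal (norm_coneKernel_dispersive (sub_ne_zero.2 hts) x)
  calc _ ≤ ∫⁻ x, ∫⁻ y, ENNReal.ofReal coneConst * ENNReal.ofReal |t - s| ^ (-(3 / 2) : ℝ)
        * (‖φ x‖ₑ * ‖ψ y‖ₑ) := by
        gcongr with x y
        exact hK _
    _ = _ := by
        have h1 (x : Sp) := lintegral_const_mul (μ := volume)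
          (ENNReal.ofReal coneConst * ENNReal.ofReal |t - s| ^ (-(3 / 2) : ℝ))
          (f := fun y => ‖φ x‖ₑ * ‖ψ y‖ₑ) (hψm.enorm.const_mul _)
        simp_rw [h1, lintegral_const_mul _ hψm.enorm]
        rw [lintegral_const_mul _ (hφm.enorm.mul_const _), lintegral_mul_const _ hφm.enorm]

theorem memLp_sliceTransform {φ : Sp → ℂ} (hφm : Measurable φ) (t : ℝ) :
    MemLp (sliceTransform t φ) 2 freqMeasure :=
  MemLp.of_bound (measurable_sliceTransform hφm t).aestronglyMeasurable _
    (Filter.Eventually.of_forall fun ξ => norm_sliceTransform_le t φ ξ)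

/-- The `L¹` norm of the regularised propagator at time `0`. -/
def energyConst : ℝ≥0∞ := 2 * ∫⁻ x, ‖coneKernel 1 x‖ₑ

theorem energyConst_ne_top : energyConst ≠ ⊤ := by
  refine ENNReal.mul_ne_top (by simp) ?_
  have := integrable_norm_coneKernel_one.hasFiniteIntegral
  rw [hasFiniteIntegral_norm_iff] at this
  exact this.ne

theorem lintegral_enorm_sliceTransform_sq_le {φ : Sp → ℂ} (hφm : Measurable φ)
    (hφ : Integrable φ) (t : ℝ) :
    ∫⁻ ξ, ‖sliceTransform t φ ξ‖ₑ ^ 2 ∂freqMeasure ≤ energyConst * ∫⁻ x, ‖φ x‖ₑ ^ 2 := by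
  rw [lintegral_enorm_sq_eq (memLp_sliceTransform hφm t)]
  refine (enorm_integral_conj_sliceTransform_mul_le hφm hφm hφ hφ t t).trans ?_
  simp only [sub_self, ofReal_zero, zero_mul, sub_zero]
  refine (lintegral_lintegral_kernel_le (κ := fun x => ‖coneKernel 1 x‖ₑ)
    (measurable_coneKernel 1).enorm hφm.enorm hφm.enorm).trans_eq ?_
  rw [energyConst]; ring

theorem enorm_integral_conj_sliceTransform_mul_le_energy {φ ψ : Sp → ℂ} (hφm : Measurable φ)
    (hψm : Measurable ψ) (hφ : Integrable φ) (hψ : Integrable ψ) (t s : ℝ) {A B : ℝ≥0∞}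
    (hA : ∫⁻ x, ‖φ x‖ₑ ^ 2 ≤ A ^ 2) (hB : ∫⁻ x, ‖ψ x‖ₑ ^ 2 ≤ B ^ 2) :
    ‖∫ ξ, conj (sliceTransform t φ ξ) * sliceTransform s ψ ξ ∂freqMeasure‖ₑ ≤
      energyConst * (A * B) := by
  refine (enorm_integral_conj_mul_le_sqrt (measurable_sliceTransform hφm t)
    (measurable_sliceTransform hψm s)).trans ?_
  have h1 := (lintegral_enorm_sliceTransform_sq_le hφm hφ t).trans (mul_le_mul_right hA _)
  have h2 := (lintegral_enorm_sliceTransform_sq_le hψm hψ s).trans (mul_le_mul_right hB _)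
  calc _ ≤ (energyConst * A ^ 2) ^ (1 / 2 : ℝ) * (energyConst * B ^ 2) ^ (1 / 2 : ℝ) := by
        gcongr
    _ = ((energyConst * (A * B)) ^ (2 : ℝ)) ^ (1 / 2 : ℝ) := by
        rw [← ENNReal.mul_rpow_of_nonneg _ _ (by norm_num), ENNReal.rpow_two]
        congr 1
        ring
    _ = _ := by rw [← ENNReal.rpow_mul]; norm_num

/-- A space-time function whose spatial slices are controlled in `L¹` and `L²` as if they were
multiples of the indicator of a set of measure `lam ^ (-6)`. -/
structure IsWaveAtom (lam : ℝ) (c : ℝ → ℝ≥0) (F : ℝ → Sp → ℂ) : Prop where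
  measurable : Measurable (Function.uncurry F)
  measurable_coeff : Measurable c
  coeff_ne_top : ∫⁻ t, c t ≠ ⊤
  l1_le : ∀ t, ∫⁻ x, ‖F t x‖ₑ ≤ ENNReal.ofReal lam⁻¹ * c t
  l2_le : ∀ t, ∫⁻ x, ‖F t x‖ₑ ^ 2 ≤ (ENNReal.ofReal (lam ^ 2) * c t) ^ 2

/-- Adjoint of the half-wave propagator on space-time, on the frequency side. -/
def waveTransform (F : ℝ → Sp → ℂ) (ξ : Sp) : ℂ := ∫ t, sliceTransform t (F t) ξ

/-- The form `⟨T F, T G⟩`, where `T` is the adjoint of the regularised propagator. -/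
def waveForm (F G : ℝ → Sp → ℂ) : ℂ :=
  ∫ ξ, conj (waveTransform F ξ) * waveTransform G ξ ∂freqMeasure

/-- The minimum of the dispersive and energy bounds. -/
def dispKernel (m τ : ℝ) : ℝ≥0∞ :=
  min (ENNReal.ofReal |τ| ^ (-(3 / 2) : ℝ) * ENNReal.ofReal m⁻¹) (ENNReal.ofReal (m ^ 2))

theorem measurable_dispKernel (m : ℝ) : Measurable (dispKernel m) := by
  unfold dispKernel; fun_prop

def formConst : ℝ≥0∞ := ENNReal.ofReal coneConst + energyConst

theorem formConst_ne_top : formConst ≠ ⊤ := by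
  simp [formConst, energyConst_ne_top]

namespace IsWaveAtom

variable {lam mu : ℝ} {c d : ℝ → ℝ≥0} {F G : ℝ → Sp → ℂ}

theorem measurable_slice (hF : IsWaveAtom lam c F) (t : ℝ) : Measurable (F t) :=
  hF.measurable.comp measurable_prodMk_left

theorem integrable_slice (hF : IsWaveAtom lam c F) (t : ℝ) : Integrable (F t) :=
  ⟨(hF.measurable_slice t).aestronglyMeasurable, (hF.l1_le t).trans_lt
    (ENNReal.mul_lt_top ENNReal.ofReal_lt_top ENNReal.coe_lt_top)⟩

theorem norm_sliceTransform_le (hF : IsWaveAtom lam c F) (t : ℝ) (ξ : Sp) :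
    ‖sliceTransform t (F t) ξ‖ ≤ (ENNReal.ofReal lam⁻¹).toReal * c t := by
  refine (_root_.norm_sliceTransform_le t (F t) ξ).trans ?_
  rw [integral_norm_eq_lintegral_enorm (hF.measurable_slice t).aestronglyMeasurable,
    ← ENNReal.coe_toReal, ← ENNReal.toReal_mul]
  exact ENNReal.toReal_mono (ENNReal.mul_ne_top ENNReal.ofReal_ne_top ENNReal.coe_ne_top)
    (hF.l1_le t)

theorem integrable_coeff (hF : IsWaveAtom lam c F) : Integrable (fun t => (c t : ℝ)) := by
  refine ⟨(measurable_coe_nnreal_real.comp hF.measurable_coeff).aestronglyMeasurable, ?_⟩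
  simp only [hasFiniteIntegral_iff_enorm, Real.enorm_eq_ofReal, NNReal.zero_le_coe,
    ENNReal.ofReal_coe_nnreal]
  exact hF.coeff_ne_top.lt_top

theorem enorm_waveForm_le (hF : IsWaveAtom lam c F) (hG : IsWaveAtom mu d G) (hl : 0 < lam)
    (hm : 0 < mu) :
    ‖waveForm F G‖ₑ ≤
      formConst * ∫⁻ t, ∫⁻ s, dispKernel (lam * mu) (t - s) * ((c t : ℝ≥0∞) * d s) := by
  refine (enorm_integral_conj_mul_le_lintegral (measurable_uncurry_sliceTransform hF.measurable)
    (measurable_uncurry_sliceTransform hG.measurable)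
    (hF.integrable_coeff.const_mul _) (hG.integrable_coeff.const_mul _)
    hF.norm_sliceTransform_le hG.norm_sliceTransform_le).trans ?_
  rw [← lintegral_const_mul' _ _ formConst_ne_top]
  refine lintegral_mono fun t => ?_
  rw [← lintegral_const_mul' _ _ formConst_ne_top]
  refine lintegral_mono fun s => ?_
  have hen := enorm_integral_conj_sliceTransform_mul_le_energy (hF.measurable_slice t)
    (hG.measurable_slice s) (hF.integrable_slice t) (hG.integrable_slice s) t s (hF.l2_le t)
    (hG.l2_le s)
  rw [dispKernel]
  have hen' : ENNReal.ofReal (lam ^ 2) * c t * (ENNReal.ofReal (mu ^ 2) * d s) =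
      ENNReal.ofReal ((lam * mu) ^ 2) * (c t * d s) := by
    rw [mul_pow, ENNReal.ofReal_mul (by positivity)]; ring
  rw [hen'] at hen
  rcases min_choice (ENNReal.ofReal |t - s| ^ (-(3 / 2) : ℝ) * ENNReal.ofReal (lam * mu)⁻¹)
    (ENNReal.ofReal ((lam * mu) ^ 2)) with h | h
  · rw [h]
    by_cases hts : t = s
    · refine hen.trans ?_
      gcongr
      · exact le_add_self
      · simp [hts, hl, hm, ENNReal.top_mul]
    refine (enorm_integral_conj_sliceTransform_mul_le_dispersive (hF.measurable_slice t)
      (hG.measurable_slice s) (hF.integrable_slice t) (hG.integrable_slice s) t s hts).trans ?_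
    calc _ ≤ formConst * ENNReal.ofReal |t - s| ^ (-(3 / 2) : ℝ) *
          ((ENNReal.ofReal lam⁻¹ * c t) * (ENNReal.ofReal mu⁻¹ * d s)) := by
          gcongr
          · exact le_self_add
          · exact hF.l1_le t
          · exact hG.l1_le s
      _ = _ := by
          rw [mul_inv, ENNReal.ofReal_mul (by positivity)]; ring
  · rw [h]
    refine hen.trans ?_
    gcongr
    exact le_add_self

end IsWaveAtom

theorem setLIntegral_Ioi_rpow {T : ℝ} (hT : 0 < T) :
    ∫⁻ τ in Set.Ioi T, ENNReal.ofReal |τ| ^ (-(3 / 2) : ℝ) =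
      ENNReal.ofReal (2 * T ^ (-(1 / 2) : ℝ)) := by
  have h1 : ∀ τ ∈ Set.Ioi T, ENNReal.ofReal |τ| ^ (-(3 / 2) : ℝ) =
      ENNReal.ofReal (τ ^ (-(3 / 2) : ℝ)) := fun τ hτ => by
    have : 0 < τ := hT.trans hτ
    rw [abs_of_pos this, ENNReal.ofReal_rpow_of_pos this]
  rw [setLIntegral_congr_fun measurableSet_Ioi h1, ← ofReal_integral_eq_lintegral_ofReal,
    integral_Ioi_rpow_of_lt (by norm_num) hT]
  · congr 1
    norm_num
    ring
  · exact integrableOn_Ioi_rpow_of_lt (by norm_num) hT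
  · exact (ae_restrict_mem measurableSet_Ioi).mono fun τ hτ =>
      Real.rpow_nonneg (hT.trans hτ).le _

/-- The kernel `|τ| ^ (-3/2)` restricted to `|τ| > T`. -/
def tailKernel (T τ : ℝ) : ℝ≥0∞ :=
  {τ : ℝ | T < |τ|}.indicator (fun τ => ENNReal.ofReal |τ| ^ (-(3 / 2) : ℝ)) τ

theorem measurable_tailKernel (T : ℝ) : Measurable (tailKernel T) :=
  Measurable.indicator (by fun_prop) (measurableSet_lt (by fun_prop) (by fun_prop))

theorem lintegral_tailKernel_le {T : ℝ} (hT : 0 < T) :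
    ∫⁻ τ, tailKernel T τ ≤ ENNReal.ofReal (4 * T ^ (-(1 / 2) : ℝ)) := by
  have hm : Measurable fun τ : ℝ => (Set.Ioi T).indicator
      (fun τ => ENNReal.ofReal |τ| ^ (-(3 / 2) : ℝ)) τ :=
    Measurable.indicator (by fun_prop) measurableSet_Ioi
  calc ∫⁻ τ, tailKernel T τ
      ≤ ∫⁻ τ, ((Set.Ioi T).indicator (fun τ => ENNReal.ofReal |τ| ^ (-(3 / 2) : ℝ)) τ +
        (Set.Ioi T).indicator (fun τ => ENNReal.ofReal |τ| ^ (-(3 / 2) : ℝ)) (-τ)) := by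
        refine lintegral_mono fun τ => ?_
        rw [tailKernel]
        refine Set.indicator_apply_le' (fun h => ?_) fun _ => zero_le
        rcases lt_abs.1 (show T < |τ| from h) with h | h
        · rw [Set.indicator_of_mem (show τ ∈ Set.Ioi T from h)]
          exact le_self_add
        · rw [Set.indicator_of_mem (show -τ ∈ Set.Ioi T from h), abs_neg]
          exact le_add_self
    _ = _ := by
        rw [lintegral_add_left hm, lintegral_neg_eq_self (f := fun τ : ℝ => (Set.Ioi T).indicator
          (fun τ => ENNReal.ofReal |τ| ^ (-(3 / 2) : ℝ)) τ), lintegral_indicator measurableSet_Ioi, setLIntegral_Ioi_rpow hT,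
          ← ENNReal.ofReal_add (by positivity) (by positivity)]
        congr 1
        ring

theorem lintegral_dispKernel_le {m : ℝ} (hm : 0 < m) : ∫⁻ τ, dispKernel m τ ≤ 6 := by
  set T : ℝ := m⁻¹ ^ 2 with hTdef
  have hT : 0 < T := by positivity
  calc ∫⁻ τ, dispKernel m τ
      ≤ ∫⁻ τ, (tailKernel T τ * ENNReal.ofReal m⁻¹ +
          (Set.Icc (-T) T).indicator (fun _ => ENNReal.ofReal (m ^ 2)) τ) := by
        refine lintegral_mono fun τ => ?_
        rw [dispKernel]
        rcases lt_or_ge T |τ| with h | h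
        · rw [tailKernel, Set.indicator_of_mem (show τ ∈ {τ : ℝ | T < |τ|} from h)]
          exact (min_le_left _ _).trans le_self_add
        · rw [Set.indicator_of_mem (show τ ∈ Set.Icc (-T) T from abs_le.1 h)]
          exact (min_le_right _ _).trans le_add_self
    _ ≤ ENNReal.ofReal (4 * T ^ (-(1 / 2) : ℝ)) * ENNReal.ofReal m⁻¹ +
        ENNReal.ofReal (m ^ 2) * ENNReal.ofReal (T - -T) := by
        rw [lintegral_add_left ((measurable_tailKernel T).mul_const _),
          lintegral_mul_const _ (measurable_tailKernel T),
          lintegral_indicator_const measurableSet_Icc, Real.volume_Icc]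
        gcongr
        exact lintegral_tailKernel_le hT
    _ = 6 := by
        rw [← ENNReal.ofReal_mul (by positivity), ← ENNReal.ofReal_mul (by positivity),
          ← ENNReal.ofReal_add (by positivity)
            (mul_nonneg (by positivity) (by linarith))]
        have : T ^ (-(1 / 2) : ℝ) = m := by
          rw [hTdef, ← Real.rpow_natCast, ← Real.rpow_mul (by positivity),
            Real.inv_rpow hm.le, ← Real.rpow_neg hm.le]
          norm_num
        rw [this, show 4 * m * m⁻¹ + m ^ 2 * (T - -T) = 6 by rw [hTdef]; field_simp; norm_num]
        simp

namespace IsWaveAtom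

variable {lam mu : ℝ} {c d : ℝ → ℝ≥0} {F G : ℝ → Sp → ℂ}

theorem measurable_waveTransform (hF : IsWaveAtom lam c F) : Measurable (waveTransform F) := by
  have h : Measurable (fun p : Sp × ℝ => sliceTransform p.2 (F p.2) p.1) :=
    (measurable_uncurry_sliceTransform hF.measurable).comp measurable_swap
  exact (h.stronglyMeasurable.integral_prod_right').measurable

theorem integrable_sliceTransform (hF : IsWaveAtom lam c F) (ξ : Sp) :
    Integrable (fun t => sliceTransform t (F t) ξ) := by
  refine (hF.integrable_coeff.const_mul (ENNReal.ofReal lam⁻¹).toReal).mono' ?_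
    (Filter.Eventually.of_forall fun t => hF.norm_sliceTransform_le t ξ)
  exact ((measurable_uncurry_sliceTransform hF.measurable).comp
    measurable_prodMk_right).aestronglyMeasurable

theorem memLp_waveTransform (hF : IsWaveAtom lam c F) :
    MemLp (waveTransform F) 2 freqMeasure := by
  refine MemLp.of_bound hF.measurable_waveTransform.aestronglyMeasurable
    (∫ t, (ENNReal.ofReal lam⁻¹).toReal * c t) (Filter.Eventually.of_forall fun ξ => ?_)
  exact norm_integral_le_of_norm_le (hF.integrable_coeff.const_mul _)
    (Filter.Eventually.of_forall fun t => hF.norm_sliceTransform_le t ξ)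

theorem integrable_conj_mul (hF : IsWaveAtom lam c F) (hG : IsWaveAtom mu d G) :
    Integrable (fun ξ => conj (waveTransform F ξ) * waveTransform G ξ) freqMeasure :=
  MemLp.integrable_mul (p := 2) (q := 2) hF.memLp_waveTransform.star hG.memLp_waveTransform

theorem enorm_waveForm_self (hF : IsWaveAtom lam c F) :
    ‖waveForm F F‖ₑ = ∫⁻ ξ, ‖waveTransform F ξ‖ₑ ^ 2 ∂freqMeasure :=
  (lintegral_enorm_sq_eq hF.memLp_waveTransform).symm

theorem enorm_waveForm_le_sqrt (hF : IsWaveAtom lam c F) (hG : IsWaveAtom mu d G) :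
    ‖waveForm F G‖ₑ ≤ ‖waveForm F F‖ₑ ^ (1 / 2 : ℝ) * ‖waveForm G G‖ₑ ^ (1 / 2 : ℝ) := by
  rw [hF.enorm_waveForm_self, hG.enorm_waveForm_self]
  exact enorm_integral_conj_mul_le_sqrt hF.measurable_waveTransform hG.measurable_waveTransform

theorem indicator (hF : IsWaveAtom lam c F) {J : Set ℝ} (hJ : MeasurableSet J) :
    IsWaveAtom lam (J.indicator c) (J.indicator F) where
  measurable := by
    classical
    have : Function.uncurry (J.indicator F) =
        (Prod.fst ⁻¹' J).indicator (Function.uncurry F) := by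
      ext ⟨t, x⟩
      by_cases h : t ∈ J <;> simp [Function.uncurry, h]
    rw [this]
    exact hF.measurable.indicator (measurable_fst hJ)
  measurable_coeff := hF.measurable_coeff.indicator hJ
  coeff_ne_top := by
    refine ne_top_of_le_ne_top hF.coeff_ne_top (lintegral_mono fun t => ?_)
    by_cases h : t ∈ J <;> simp [h]
  l1_le t := by
    by_cases h : t ∈ J
    · simpa [h] using hF.l1_le t
    · simp [h]
  l2_le t := by
    by_cases h : t ∈ J
    · simpa [h] using hF.l2_le t
    · simp [h]

theorem enorm_waveForm_self_le (hF : IsWaveAtom lam c F) (hl : 0 < lam) :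
    ‖waveForm F F‖ₑ ≤ 12 * formConst * ∫⁻ t, (c t : ℝ≥0∞) ^ 2 := by
  have hc : Measurable fun t => (c t : ℝ≥0∞) := hF.measurable_coeff.coe_nnreal_ennreal
  refine (hF.enorm_waveForm_le hF hl hl).trans ?_
  calc _ ≤ formConst * ((∫⁻ τ, dispKernel (lam * lam) τ) *
        ((∫⁻ t, (c t : ℝ≥0∞) ^ 2) + ∫⁻ t, (c t : ℝ≥0∞) ^ 2)) := by
        gcongr
        exact lintegral_lintegral_kernel_le (measurable_dispKernel _) hc hc
    _ ≤ formConst * (6 * ((∫⁻ t, (c t : ℝ≥0∞) ^ 2) + ∫⁻ t, (c t : ℝ≥0∞) ^ 2)) := by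
        gcongr
        exact lintegral_dispKernel_le (by positivity)
    _ = _ := by ring

theorem enorm_waveForm_self_le_of_length (hF : IsWaveAtom lam c F) (hl : 0 < lam) {T : ℝ}
    (hT : ∀ t s, c t ≠ 0 → c s ≠ 0 → |t - s| ≤ T) :
    ‖waveForm F F‖ₑ ≤
      4 * formConst * ENNReal.ofReal (lam ^ 4 * T) * ∫⁻ t, (c t : ℝ≥0∞) ^ 2 := by
  have hc : Measurable fun t => (c t : ℝ≥0∞) := hF.measurable_coeff.coe_nnreal_ennreal
  refine (hF.enorm_waveForm_le hF hl hl).trans ?_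
  set κ : ℝ → ℝ≥0∞ := (Set.Icc (-T) T).indicator fun _ => ENNReal.ofReal ((lam * lam) ^ 2)
  calc _ ≤ formConst * ∫⁻ t, ∫⁻ s, κ (t - s) * ((c t : ℝ≥0∞) * c s) := by
        refine mul_le_mul_right (lintegral_mono fun t => lintegral_mono fun s => ?_) _
        by_cases ht : c t = 0
        · simp [ht]
        by_cases hs : c s = 0
        · simp [hs]
        gcongr
        rw [show κ (t - s) = _ from Set.indicator_of_mem
          (show t - s ∈ Set.Icc (-T) T from abs_le.1 (hT t s ht hs)) _]
        exact min_le_right _ _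
    _ ≤ formConst * ((∫⁻ τ, κ τ) *
        ((∫⁻ t, (c t : ℝ≥0∞) ^ 2) + ∫⁻ t, (c t : ℝ≥0∞) ^ 2)) := by
        gcongr
        exact lintegral_lintegral_kernel_le (measurable_const.indicator measurableSet_Icc) hc hc
    _ = _ := by
        rw [lintegral_indicator_const measurableSet_Icc, Real.volume_Icc,
          ← ENNReal.ofReal_mul (by positivity),
          show (lam * lam) ^ 2 * (T - -T) = 2 * (lam ^ 4 * T) by ring,
          ENNReal.ofReal_mul (by norm_num), ENNReal.ofReal_ofNat]
        ring

end IsWaveAtom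

theorem waveTransform_sum {ι : Type*} {I : Finset ι} {lam : ι → ℝ} {c : ι → ℝ → ℝ≥0}
    {F : ι → ℝ → Sp → ℂ} (hF : ∀ i ∈ I, IsWaveAtom (lam i) (c i) (F i)) :
    waveTransform (fun t x => ∑ i ∈ I, F i t x) = fun ξ => ∑ i ∈ I, waveTransform (F i) ξ := by
  ext ξ
  unfold waveTransform
  rw [← integral_finsetSum _ fun i hi => (hF i hi).integrable_sliceTransform ξ]
  refine integral_congr_ae (Filter.Eventually.of_forall fun t => ?_)
  simp only [sliceTransform, Finset.sum_mul]
  refine integral_finsetSum _ fun i hi => ?_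
  refine ((hF i hi).integrable_slice t).mul_bdd (c := 1) ?_ (by simp)
  exact (continuous_waveChar.comp (f := fun x : Sp => (t, x, ξ))
    (by fun_prop)).aestronglyMeasurable

theorem waveForm_sum_left {ι : Type*} {I : Finset ι} {lam : ι → ℝ} {c : ι → ℝ → ℝ≥0}
    {F : ι → ℝ → Sp → ℂ} (hF : ∀ i ∈ I, IsWaveAtom (lam i) (c i) (F i)) {mu : ℝ} {d : ℝ → ℝ≥0}
    {G : ℝ → Sp → ℂ} (hG : IsWaveAtom mu d G) :
    waveForm (fun t x => ∑ i ∈ I, F i t x) G = ∑ i ∈ I, waveForm (F i) G := by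
  unfold waveForm
  rw [waveTransform_sum hF, ← integral_finsetSum _ fun i hi => (hF i hi).integrable_conj_mul hG]
  simp_rw [map_sum, Finset.sum_mul]

theorem waveForm_conj (F G : ℝ → Sp → ℂ) : conj (waveForm F G) = waveForm G F := by
  unfold waveForm
  rw [← integral_conj]
  congr with ξ
  simp [mul_comm]

theorem enorm_waveForm_comm (F G : ℝ → Sp → ℂ) : ‖waveForm F G‖ₑ = ‖waveForm G F‖ₑ := by
  rw [← waveForm_conj, RCLike.enorm_conj]

theorem enorm_waveForm_sum_le {ι : Type*} {I : Finset ι} {lam : ι → ℝ} {c : ι → ℝ → ℝ≥0}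
    {F : ι → ℝ → Sp → ℂ} (hF : ∀ i ∈ I, IsWaveAtom (lam i) (c i) (F i)) {mu : ℝ} {d : ℝ → ℝ≥0}
    {G : ℝ → Sp → ℂ} (hG : IsWaveAtom mu d G) :
    ‖waveForm (fun t x => ∑ i ∈ I, F i t x) G‖ₑ ≤ ∑ i ∈ I, ‖waveForm (F i) G‖ₑ := by
  rw [waveForm_sum_left hF hG]
  exact enorm_sum_le _ _

theorem IsWaveAtom.enorm_waveForm_le_indicator_add {lam mu : ℝ} {c d : ℝ → ℝ≥0}
    {F G : ℝ → Sp → ℂ} (hF : IsWaveAtom lam c F) (hG : IsWaveAtom mu d G) {J : Set ℝ}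
    (hJ : MeasurableSet J) :
    ‖waveForm F G‖ₑ ≤ ‖waveForm F (J.indicator G)‖ₑ + ‖waveForm F (Jᶜ.indicator G)‖ₑ := by
  have h := enorm_waveForm_sum_le (I := Finset.univ) (lam := fun _ : Bool => mu)
    (c := fun b => cond b (J.indicator d) (Jᶜ.indicator d))
    (F := fun b => cond b (J.indicator G) (Jᶜ.indicator G))
    (fun b _ => by cases b; exacts [hG.indicator hJ.compl, hG.indicator hJ]) hF
  simp only [Fintype.sum_bool, cond_true, cond_false] at h
  have hs : (fun t x => J.indicator G t x + Jᶜ.indicator G t x) = G := by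
    ext t x
    exact congrFun (congrFun (Set.indicator_self_add_compl J G) t) x
  rw [hs] at h
  simpa only [enorm_waveForm_comm F] using h

theorem sqrt_mul_sqrt_le_add (a b : ℝ≥0∞) :
    a ^ (1 / 2 : ℝ) * b ^ (1 / 2 : ℝ) ≤ a + b := by
  refine (mul_le_sq_add_sq_ennreal _ _).trans_eq ?_
  simp_rw [← ENNReal.rpow_two, ← ENNReal.rpow_mul]
  norm_num

theorem lintegral_indicator_coe_sq {J : Set ℝ} (hJ : MeasurableSet J) (c : ℝ → ℝ≥0) :
    ∫⁻ t, ((J.indicator c t : ℝ≥0) : ℝ≥0∞) ^ 2 = ∫⁻ t in J, (c t : ℝ≥0∞) ^ 2 := by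
  rw [← lintegral_indicator hJ]
  refine lintegral_congr fun t => ?_
  by_cases h : t ∈ J <;> simp [h]

theorem sum_setLIntegral_le {I : Finset ℤ} {J : ℤ → Set ℝ} (hJ : ∀ i, MeasurableSet (J i)) {k : ℕ}
    (hk : ∀ t, ∃ S : Finset ℤ, S.card ≤ k ∧ ∀ i, t ∈ J i → i ∈ S) {h : ℝ → ℝ≥0∞}
    (hh : Measurable h) :
    ∑ i ∈ I, ∫⁻ t in J i, h t ≤ k * ∫⁻ t, h t := by
  simp_rw [← lintegral_indicator (hJ _)]
  rw [← lintegral_finsetSum _ fun i _ => hh.indicator (hJ i), ← lintegral_const_mul _ hh]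
  refine lintegral_mono fun t => ?_
  obtain ⟨S, hS, hSt⟩ := hk t
  calc ∑ i ∈ I, (J i).indicator h t ≤ ∑ i ∈ I ∪ S, (J i).indicator h t :=
        Finset.sum_le_sum_of_subset Finset.subset_union_left
    _ = ∑ i ∈ S, (J i).indicator h t := by
        refine (Finset.sum_subset Finset.subset_union_right fun i _ hi => ?_).symm
        exact Set.indicator_of_notMem (fun h => hi (hSt i h)) _
    _ ≤ ∑ i ∈ S, h t := Finset.sum_le_sum fun i _ => Set.indicator_le_self _ _ _
    _ ≤ _ := by
        rw [Finset.sum_const, nsmul_eq_mul]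
        gcongr

/-- Half-open time intervals of length `T`. -/
def timeSlab (T : ℝ) (i : ℤ) : Set ℝ := {t | ⌊t / T⌋ = i}

/-- The union of a time slab and its two neighbours. -/
def timeNhd (T : ℝ) (i : ℤ) : Set ℝ := {t | |⌊t / T⌋ - i| ≤ 1}

theorem measurableSet_timeSlab (T : ℝ) (i : ℤ) : MeasurableSet (timeSlab T i) :=
  measurableSet_eq_fun (by fun_prop) measurable_const

theorem measurableSet_timeNhd (T : ℝ) (i : ℤ) : MeasurableSet (timeNhd T i) := by
  have h : Measurable fun t : ℝ => ⌊t / T⌋ := by fun_prop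
  exact h (MeasurableSet.of_discrete (s := {j : ℤ | |j - i| ≤ 1}))

theorem abs_sub_le_of_mem_timeSlab {T : ℝ} (hT : 0 < T) {i : ℤ} {t s : ℝ}
    (ht : t ∈ timeSlab T i) (hs : s ∈ timeSlab T i) : |t - s| ≤ T := by
  obtain ⟨h1, h2⟩ := Int.floor_eq_iff.1 ht
  obtain ⟨h3, h4⟩ := Int.floor_eq_iff.1 hs
  rw [le_div_iff₀ hT] at h1 h3
  rw [div_lt_iff₀ hT] at h2 h4
  rw [abs_le]; constructor <;> linarith

theorem lt_abs_sub_of_notMem_timeNhd {T : ℝ} (hT : 0 < T) {i : ℤ} {t s : ℝ}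
    (ht : t ∈ timeSlab T i) (hs : s ∉ timeNhd T i) : T < |t - s| := by
  obtain ⟨h1, h2⟩ := Int.floor_eq_iff.1 ht
  have hs' : ¬ |⌊s / T⌋ - i| ≤ 1 := hs
  rw [le_div_iff₀ hT] at h1
  rw [div_lt_iff₀ hT] at h2
  rw [not_le, lt_abs] at hs'
  rw [lt_abs]
  rcases hs' with h | h
  · right
    have h3 : (i : ℝ) + 2 ≤ s / T :=
      le_trans (by exact_mod_cast (by omega : i + 2 ≤ ⌊s / T⌋)) (Int.floor_le _)
    rw [le_div_iff₀ hT] at h3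
    linarith
  · left
    have h3 : s / T < (i : ℝ) - 1 :=
      (Int.lt_floor_add_one _).trans_le (by exact_mod_cast (by omega : ⌊s / T⌋ + 1 ≤ i - 1))
    rw [div_lt_iff₀ hT] at h3
    linarith

namespace IsWaveAtom

variable {lam mu : ℝ} {c d : ℝ → ℝ≥0} {F G : ℝ → Sp → ℂ}

theorem enorm_waveForm_near_le (hF : IsWaveAtom lam c F) (hG : IsWaveAtom mu d G) (hl : 0 < lam)
    (hm : 0 < mu) {T : ℝ} (hTl : lam ^ 4 * T = lam / mu)
    (hT : ∀ t s, c t ≠ 0 → c s ≠ 0 → |t - s| ≤ T) :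
    ‖waveForm F G‖ₑ ≤ 12 * formConst * ENNReal.ofReal √(lam / mu) *
      ((∫⁻ t, (c t : ℝ≥0∞) ^ 2) + ∫⁻ t, (d t : ℝ≥0∞) ^ 2) := by
  refine (hF.enorm_waveForm_le_sqrt hG).trans ?_
  have hρ : ENNReal.ofReal (lam / mu) = ENNReal.ofReal √(lam / mu) ^ 2 := by
    rw [← ENNReal.ofReal_pow (by positivity), Real.sq_sqrt (by positivity)]
  have h1 : ‖waveForm F F‖ₑ ≤ 12 * formConst * ENNReal.ofReal √(lam / mu) ^ 2 *
      ∫⁻ t, (c t : ℝ≥0∞) ^ 2 := by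
    refine (hF.enorm_waveForm_self_le_of_length hl hT).trans ?_
    rw [hTl, hρ]
    gcongr
    norm_num
  calc _ ≤ (12 * formConst * ENNReal.ofReal √(lam / mu) ^ 2 *
        ∫⁻ t, (c t : ℝ≥0∞) ^ 2) ^ (1 / 2 : ℝ) *
        (12 * formConst * ∫⁻ t, (d t : ℝ≥0∞) ^ 2) ^ (1 / 2 : ℝ) := by
        gcongr
        exact hG.enorm_waveForm_self_le hm
    _ = (((12 * formConst * ENNReal.ofReal √(lam / mu)) ^ (2 : ℝ)) ^ (1 / 2 : ℝ)) *
        ((∫⁻ t, (c t : ℝ≥0∞) ^ 2) ^ (1 / 2 : ℝ) * (∫⁻ t, (d t : ℝ≥0∞) ^ 2) ^ (1 / 2 : ℝ)) := by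
        simp_rw [← ENNReal.mul_rpow_of_nonneg _ _ (show (0 : ℝ) ≤ 1 / 2 by norm_num)]
        rw [ENNReal.rpow_two]
        congr 1
        ring
    _ ≤ _ := by
        rw [← ENNReal.rpow_mul]
        norm_num only
        rw [ENNReal.rpow_one]
        gcongr
        have := sqrt_mul_sqrt_le_add (∫⁻ t, (c t : ℝ≥0∞) ^ 2) (∫⁻ t, (d t : ℝ≥0∞) ^ 2)
        exact this

theorem sum_enorm_waveForm_far_le (hF : IsWaveAtom lam c F) (hG : IsWaveAtom mu d G)
    (hl : 0 < lam) (hm : 0 < mu) {T : ℝ} (hT : 0 < T) (I : Finset ℤ) :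
    ∑ i ∈ I, ‖waveForm ((timeSlab T i).indicator F) ((timeNhd T i)ᶜ.indicator G)‖ₑ ≤
      formConst * ENNReal.ofReal (4 * T ^ (-(1 / 2) : ℝ) * (lam * mu)⁻¹) *
        ((∫⁻ t, (c t : ℝ≥0∞) ^ 2) + ∫⁻ t, (d t : ℝ≥0∞) ^ 2) := by
  have hc : Measurable fun t => (c t : ℝ≥0∞) := hF.measurable_coeff.coe_nnreal_ennreal
  have hd : Measurable fun t => (d t : ℝ≥0∞) := hG.measurable_coeff.coe_nnreal_ennreal
  set κ : ℝ → ℝ≥0∞ := fun τ => tailKernel T τ * ENNReal.ofReal (lam * mu)⁻¹ with hκ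
  have hκm : Measurable κ := (measurable_tailKernel T).mul_const _
  have hci (i : ℤ) : Measurable fun t => (((timeSlab T i).indicator c t : ℝ≥0) : ℝ≥0∞) :=
    (hF.measurable_coeff.indicator (measurableSet_timeSlab T i)).coe_nnreal_ennreal
  have hκ2 : Measurable (fun p : ℝ × ℝ => κ (p.1 - p.2)) := hκm.comp (by fun_prop)
  have hmeas (i : ℤ) : Measurable fun p : ℝ × ℝ =>
      κ (p.1 - p.2) * ((((timeSlab T i).indicator c p.1 : ℝ≥0) : ℝ≥0∞) * d p.2) :=
    hκ2.mul (((hci i).comp measurable_fst).mul (hd.comp measurable_snd))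
  calc _ ≤ ∑ i ∈ I, formConst * ∫⁻ t, ∫⁻ s,
        κ (t - s) * ((((timeSlab T i).indicator c t : ℝ≥0) : ℝ≥0∞) * d s) := by
        refine Finset.sum_le_sum fun i _ => ?_
        refine ((hF.indicator (measurableSet_timeSlab T i)).enorm_waveForm_le
          (hG.indicator (measurableSet_timeNhd T i).compl) hl hm).trans ?_
        refine mul_le_mul_right (lintegral_mono fun t => lintegral_mono fun s => ?_) _
        by_cases ht : t ∈ timeSlab T i
        swap
        · simp [ht]
        by_cases hs : s ∈ timeNhd T i
        · simp [hs]
        rw [Set.indicator_of_mem (show s ∈ (timeNhd T i)ᶜ from hs)]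
        gcongr
        simp only [hκ, tailKernel]
        rw [Set.indicator_of_mem (show t - s ∈ {τ : ℝ | T < |τ|} from
          lt_abs_sub_of_notMem_timeNhd hT ht hs)]
        exact min_le_left _ _
    _ ≤ formConst * ∫⁻ t, ∫⁻ s, κ (t - s) * ((c t : ℝ≥0∞) * d s) := by
        rw [← Finset.mul_sum, ← lintegral_finsetSum _ fun i _ => (hmeas i).lintegral_prod_right']
        refine mul_le_mul_right (lintegral_mono fun t => ?_) _
        have hms (i : ℤ) : Measurable fun s =>
            κ (t - s) * ((((timeSlab T i).indicator c t : ℝ≥0) : ℝ≥0∞) * d s) :=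
          (hmeas i).comp measurable_prodMk_left
        rw [← lintegral_finsetSum _ fun i _ => hms i]
        refine lintegral_mono fun s => ?_
        rw [← Finset.mul_sum, ← Finset.sum_mul]
        gcongr
        rw [← ENNReal.ofNNReal_finsetSum]
        gcongr
        simp only [timeSlab, Set.indicator_apply, Set.mem_ofPred_eq, Finset.sum_ite_eq]
        split_ifs <;> simp
    _ ≤ formConst * ((∫⁻ τ, κ τ) *
        ((∫⁻ t, (c t : ℝ≥0∞) ^ 2) + ∫⁻ t, (d t : ℝ≥0∞) ^ 2)) := by
        gcongr
        exact lintegral_lintegral_kernel_le hκm hc hd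
    _ ≤ _ := by
        rw [mul_assoc]
        gcongr
        rw [hκ, lintegral_mul_const _ (measurable_tailKernel T), ENNReal.ofReal_mul (by positivity)]
        gcongr
        exact lintegral_tailKernel_le hT

theorem enorm_waveForm_le_sqrt_div (hF : IsWaveAtom lam c F) (hG : IsWaveAtom mu d G)
    (hl : 0 < lam) (hm : 0 < mu) {R : ℝ} (hR : ∀ t, R < |t| → F t = 0) :
    ‖waveForm F G‖ₑ ≤ 40 * formConst * ENNReal.ofReal √(lam / mu) *
      ((∫⁻ t, (c t : ℝ≥0∞) ^ 2) + ∫⁻ t, (d t : ℝ≥0∞) ^ 2) := by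
  set T : ℝ := (lam ^ 3 * mu)⁻¹ with hTdef
  have hT : 0 < T := by positivity
  have hTl : lam ^ 4 * T = lam / mu := by rw [hTdef]; field_simp
  have hc2 : Measurable fun t => (c t : ℝ≥0∞) ^ 2 :=
    hF.measurable_coeff.coe_nnreal_ennreal.pow_const 2
  have hd2 : Measurable fun t => (d t : ℝ≥0∞) ^ 2 :=
    hG.measurable_coeff.coe_nnreal_ennreal.pow_const 2
  set I : Finset ℤ := Finset.Icc ⌊-R / T⌋ ⌊R / T⌋ with hI
  have hFsum : (fun t x => ∑ i ∈ I, (timeSlab T i).indicator F t x) = F := by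
    ext t x
    by_cases ht : R < |t|
    · have h0 : F t x = 0 := by rw [hR t ht]; rfl
      rw [h0]
      refine Finset.sum_eq_zero fun i _ => ?_
      by_cases h : t ∈ timeSlab T i <;> simp [h, h0]
    · rw [not_lt, abs_le] at ht
      rw [Finset.sum_eq_single ⌊t / T⌋]
      · rw [Set.indicator_of_mem (show t ∈ timeSlab T ⌊t / T⌋ from rfl)]
      · intro i _ hi
        rw [Set.indicator_of_notMem (show t ∉ timeSlab T i from fun h => hi h.symm)]
        rfl
      · intro h
        refine absurd (Finset.mem_Icc.2 ⟨?_, ?_⟩) h <;> gcongr <;> linarith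
  have hFi (i : ℤ) := hF.indicator (measurableSet_timeSlab T i)
  have hGi (i : ℤ) := hG.indicator (measurableSet_timeNhd T i)
  have hfar : 4 * T ^ (-(1 / 2) : ℝ) * (lam * mu)⁻¹ = 4 * √(lam / mu) := by
    have h1 : T ^ (-(1 / 2) : ℝ) = √(lam ^ 3 * mu) := by
      rw [hTdef, Real.inv_rpow (by positivity), Real.rpow_neg (by positivity), inv_inv,
        Real.sqrt_eq_rpow]
    have h2 : √(lam ^ 3 * mu) = lam * mu * √(lam / mu) := by
      rw [show lam ^ 3 * mu = (lam * mu) ^ 2 * (lam / mu) by field_simp,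
        Real.sqrt_mul (by positivity), Real.sqrt_sq (by positivity)]
    rw [h1, h2]
    field_simp
  calc ‖waveForm F G‖ₑ ≤ ∑ i ∈ I, ‖waveForm ((timeSlab T i).indicator F) G‖ₑ := by
        have := enorm_waveForm_sum_le (I := I) (fun i _ => hFi i) hG
        rwa [hFsum] at this
    _ ≤ ∑ i ∈ I, (‖waveForm ((timeSlab T i).indicator F) ((timeNhd T i).indicator G)‖ₑ +
        ‖waveForm ((timeSlab T i).indicator F) ((timeNhd T i)ᶜ.indicator G)‖ₑ) :=
        Finset.sum_le_sum fun i _ =>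
          (hFi i).enorm_waveForm_le_indicator_add hG (measurableSet_timeNhd T i)
    _ ≤ ∑ i ∈ I, 12 * formConst * ENNReal.ofReal √(lam / mu) *
          ((∫⁻ t in timeSlab T i, (c t : ℝ≥0∞) ^ 2) + ∫⁻ t in timeNhd T i, (d t : ℝ≥0∞) ^ 2) +
        formConst * ENNReal.ofReal (4 * T ^ (-(1 / 2) : ℝ) * (lam * mu)⁻¹) *
          ((∫⁻ t, (c t : ℝ≥0∞) ^ 2) + ∫⁻ t, (d t : ℝ≥0∞) ^ 2) := by
        rw [Finset.sum_add_distrib]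
        refine add_le_add (Finset.sum_le_sum fun i _ => ?_)
          (hF.sum_enorm_waveForm_far_le hG hl hm hT I)
        rw [← lintegral_indicator_coe_sq (measurableSet_timeSlab T i),
          ← lintegral_indicator_coe_sq (measurableSet_timeNhd T i)]
        refine (hFi i).enorm_waveForm_near_le (hGi i) hl hm hTl fun t s ht hs => ?_
        exact abs_sub_le_of_mem_timeSlab hT (Set.mem_of_indicator_ne_zero ht)
          (Set.mem_of_indicator_ne_zero hs)
    _ ≤ 12 * formConst * ENNReal.ofReal √(lam / mu) *
          ((1 : ℕ) * (∫⁻ t, (c t : ℝ≥0∞) ^ 2) + (3 : ℕ) * ∫⁻ t, (d t : ℝ≥0∞) ^ 2) +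
        formConst * ENNReal.ofReal (4 * √(lam / mu)) *
          ((∫⁻ t, (c t : ℝ≥0∞) ^ 2) + ∫⁻ t, (d t : ℝ≥0∞) ^ 2) := by
        rw [← Finset.mul_sum, Finset.sum_add_distrib, hfar]
        gcongr
        · exact sum_setLIntegral_le (measurableSet_timeSlab T)
            (fun t => ⟨{⌊t / T⌋}, by simp, fun i hi => by simpa using hi.symm⟩) hc2
        · refine sum_setLIntegral_le (measurableSet_timeNhd T)
            (fun t => ⟨Finset.Icc (⌊t / T⌋ - 1) (⌊t / T⌋ + 1), ?_, fun i hi => ?_⟩) hd2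
          · rw [Int.card_Icc]; omega
          · have := abs_le.1 (show |⌊t / T⌋ - i| ≤ 1 from hi)
            rw [Finset.mem_Icc]
            omega
    _ ≤ 12 * formConst * ENNReal.ofReal √(lam / mu) *
          (3 * (∫⁻ t, (c t : ℝ≥0∞) ^ 2) + 3 * ∫⁻ t, (d t : ℝ≥0∞) ^ 2) +
        formConst * ENNReal.ofReal (4 * √(lam / mu)) *
          ((∫⁻ t, (c t : ℝ≥0∞) ^ 2) + ∫⁻ t, (d t : ℝ≥0∞) ^ 2) := by
        gcongr
        · norm_num
        · norm_num
    _ = _ := by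
        rw [ENNReal.ofReal_mul (by norm_num), ENNReal.ofReal_ofNat]
        ring

end IsWaveAtom

theorem waveForm_sum_sum {ι : Type*} {I : Finset ι} {lam : ι → ℝ} {c : ι → ℝ → ℝ≥0}
    {F : ι → ℝ → Sp → ℂ} (hF : ∀ i ∈ I, IsWaveAtom (lam i) (c i) (F i)) :
    waveForm (fun t x => ∑ i ∈ I, F i t x) (fun t x => ∑ i ∈ I, F i t x) =
      ∑ i ∈ I, ∑ j ∈ I, waveForm (F i) (F j) := by
  unfold waveForm
  rw [waveTransform_sum hF]
  simp_rw [map_sum, Finset.sum_mul_sum]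
  rw [integral_finsetSum _ fun i hi => integrable_finsetSum _ fun j hj =>
    (hF i hi).integrable_conj_mul (hF j hj)]
  exact Finset.sum_congr rfl fun i hi => integral_finsetSum _ fun j hj =>
    (hF i hi).integrable_conj_mul (hF j hj)

/-- The sum over the integers of `2 ^ (-|m|)`. -/
def geomSum : ℝ≥0∞ := ∑' m : ℤ, ENNReal.ofReal ((1 / 2 : ℝ) ^ m.natAbs)

theorem geomSum_ne_top : geomSum ≠ ⊤ := by
  refine Summable.tsum_ofReal_ne_top (Summable.of_nat_of_neg ?_ ?_)
  · simpa using summable_geometric_two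
  · simpa using summable_geometric_two

theorem sum_geom_le (I : Finset ℤ) (n : ℤ) :
    ∑ m ∈ I, ENNReal.ofReal ((1 / 2 : ℝ) ^ (n - m).natAbs) ≤ geomSum := by
  refine (ENNReal.sum_le_tsum I).trans_eq ?_
  exact (Equiv.subLeft n).tsum_eq fun m : ℤ => ENNReal.ofReal ((1 / 2 : ℝ) ^ m.natAbs)

/-- The constant in the almost orthogonality estimate. -/
def orthConst : ℝ≥0∞ := 40 * formConst * (2 * geomSum)

theorem orthConst_ne_top : orthConst ≠ ⊤ :=
  ENNReal.mul_ne_top (ENNReal.mul_ne_top (by simp) formConst_ne_top)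
    (ENNReal.mul_ne_top (by simp) geomSum_ne_top)

theorem sqrt_four_zpow_div {n m : ℤ} (h : n ≤ m) :
    √((4 : ℝ) ^ n / 4 ^ m) = (1 / 2) ^ (n - m).natAbs := by
  obtain ⟨k, rfl⟩ : ∃ k : ℕ, m = n + k := ⟨(m - n).toNat, by omega⟩
  rw [show (n - (n + k : ℤ)).natAbs = k by omega, zpow_add₀ (by norm_num), zpow_natCast,
    show (4 : ℝ) ^ n / (4 ^ n * 4 ^ k) = ((1 / 2) ^ k) ^ 2 by
      rw [← pow_mul, mul_comm k 2, pow_mul]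
      field_simp
      rw [← mul_pow]; norm_num]
  exact Real.sqrt_sq (by positivity)

theorem enorm_waveForm_le_geom {n m : ℤ} {c d : ℝ → ℝ≥0} {F G : ℝ → Sp → ℂ}
    (hF : IsWaveAtom (4 ^ n) c F) (hG : IsWaveAtom (4 ^ m) d G) {R : ℝ}
    (hFR : ∀ t, R < |t| → F t = 0) (hGR : ∀ t, R < |t| → G t = 0) :
    ‖waveForm F G‖ₑ ≤ 40 * formConst * ENNReal.ofReal ((1 / 2 : ℝ) ^ (n - m).natAbs) *
      ((∫⁻ t, (c t : ℝ≥0∞) ^ 2) + ∫⁻ t, (d t : ℝ≥0∞) ^ 2) := by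
  rcases le_total n m with h | h
  · rw [← sqrt_four_zpow_div h]
    exact hF.enorm_waveForm_le_sqrt_div hG (by positivity) (by positivity) hFR
  · rw [enorm_waveForm_comm, add_comm, show (n - m).natAbs = (m - n).natAbs by omega,
      ← sqrt_four_zpow_div h]
    exact hG.enorm_waveForm_le_sqrt_div hF (by positivity) (by positivity) hGR

theorem enorm_waveForm_sum_self_le {I : Finset ℤ} {c : ℤ → ℝ → ℝ≥0} {G : ℤ → ℝ → Sp → ℂ}
    (hG : ∀ n ∈ I, IsWaveAtom (4 ^ n) (c n) (G n)) {R : ℝ} (hR : ∀ n t, R < |t| → G n t = 0) :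
    ‖waveForm (fun t x => ∑ n ∈ I, G n t x) (fun t x => ∑ n ∈ I, G n t x)‖ₑ ≤
      orthConst * ∑ n ∈ I, ∫⁻ t, (c n t : ℝ≥0∞) ^ 2 := by
  rw [waveForm_sum_sum hG]
  set A : ℤ → ℝ≥0∞ := fun n => ∫⁻ t, (c n t : ℝ≥0∞) ^ 2
  set g : ℤ → ℤ → ℝ≥0∞ := fun n m => ENNReal.ofReal ((1 / 2 : ℝ) ^ (n - m).natAbs) with hg
  have hsymm (n m : ℤ) : g n m = g m n := by
    simp only [hg, show (n - m).natAbs = (m - n).natAbs by omega]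
  have hsum : ∑ n ∈ I, ∑ m ∈ I, g n m * A n ≤ geomSum * ∑ n ∈ I, A n := by
    rw [Finset.mul_sum]
    refine Finset.sum_le_sum fun n _ => ?_
    rw [← Finset.sum_mul]
    gcongr
    exact sum_geom_le I n
  calc _ ≤ ∑ n ∈ I, ∑ m ∈ I, ‖waveForm (G n) (G m)‖ₑ :=
        (enorm_sum_le _ _).trans (Finset.sum_le_sum fun n _ => enorm_sum_le _ _)
    _ ≤ ∑ n ∈ I, ∑ m ∈ I, 40 * formConst * (g n m * A n + g m n * A m) := by
        refine Finset.sum_le_sum fun n hn => Finset.sum_le_sum fun m hm => ?_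
        refine (enorm_waveForm_le_geom (hG n hn) (hG m hm) (hR n) (hR m)).trans_eq ?_
        rw [hsymm m n, ← mul_add, mul_assoc]
    _ = 40 * formConst * (∑ n ∈ I, ∑ m ∈ I, g n m * A n + ∑ n ∈ I, ∑ m ∈ I, g n m * A n) := by
        simp_rw [← Finset.mul_sum, Finset.sum_add_distrib]
        rw [Finset.sum_comm (f := fun n m => g m n * A m)]
    _ ≤ 40 * formConst * (geomSum * ∑ n ∈ I, A n + geomSum * ∑ n ∈ I, A n) := by gcongr
    _ = _ := by rw [orthConst]; ring

theorem ENNReal.le_mul_of_le_sqrt_mul_sqrt {S K P : ℝ≥0∞} (hS : S ≠ ⊤)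
    (h : S ≤ (K * S) ^ (1 / 2 : ℝ) * P ^ (1 / 2 : ℝ)) : S ≤ K * P := by
  by_cases h0 : S = 0
  · simp [h0]
  have h1 : S ^ (2 : ℝ) ≤ K * S * P := by
    calc S ^ (2 : ℝ) ≤ ((K * S) ^ (1 / 2 : ℝ) * P ^ (1 / 2 : ℝ)) ^ (2 : ℝ) := by gcongr
      _ = K * S * P := by
        rw [ENNReal.mul_rpow_of_nonneg _ _ (by norm_num), ← ENNReal.rpow_mul, ← ENNReal.rpow_mul]
        norm_num
  rw [ENNReal.rpow_two, sq, show K * S * P = S * (K * P) by ring] at h1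
  exact (ENNReal.mul_le_mul_iff_right h0 hS).1 h1

/-- Duality: a weighted `L²` norm of a superposition of characters is controlled by the adjoint
superposition. -/
theorem lintegral_mul_enorm_sq_le_of_pairing {X Ξ : Type*} [MeasurableSpace X]
    [MeasurableSpace Ξ] {μ : Measure X} {ν : Measure Ξ} [SFinite μ] [SFinite ν]
    {e : X → Ξ → ℂ} (he : Measurable (Function.uncurry e)) (he1 : ∀ x ξ, ‖e x ξ‖ ≤ 1)
    {ψ : Ξ → ℂ} (hψm : Measurable ψ) (hψ : Integrable ψ ν) {u : X → ℂ}
    (hu : ∀ x, u x = ∫ ξ, conj (e x ξ) * ψ ξ ∂ν) (hum : Measurable u) {g : X → ℝ≥0}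
    (hgm : Measurable g) (hg : Integrable (fun x => (g x : ℂ) * u x) μ) :
    ∫⁻ x, g x * ‖u x‖ₑ ^ 2 ∂μ ≤
      (∫⁻ ξ, ‖∫ x, (g x : ℂ) * u x * e x ξ ∂μ‖ₑ ^ 2 ∂ν) ^ (1 / 2 : ℝ) *
        (∫⁻ ξ, ‖ψ ξ‖ₑ ^ 2 ∂ν) ^ (1 / 2 : ℝ) := by
  have hgm' : Measurable fun x => (g x : ℂ) * u x :=
    (Complex.measurable_ofReal.comp (measurable_coe_nnreal_real.comp hgm)).mul hum
  have hint : Integrable (fun x => ((g x * ‖u x‖ ^ 2 : ℝ) : ℂ)) μ := by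
    have hb : ∀ x, ‖u x‖ ≤ ∫ ξ, ‖ψ ξ‖ ∂ν := fun x => by
      rw [hu]
      refine norm_integral_le_of_norm_le hψ.norm (Filter.Eventually.of_forall fun ξ => ?_)
      rw [norm_mul, RCLike.norm_conj]
      exact mul_le_of_le_one_left (norm_nonneg _) (he1 x ξ)
    refine (hg.norm.mul_const (∫ ξ, ‖ψ ξ‖ ∂ν)).mono' (by fun_prop)
      (Filter.Eventually.of_forall fun x => ?_)
    rw [norm_real, Real.norm_of_nonneg (by positivity), norm_mul, norm_real,
      Real.norm_of_nonneg (by positivity), sq, ← mul_assoc]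
    gcongr
    exact hb x
  have hprod : Integrable (Function.uncurry fun x ξ =>
      conj ((g x : ℂ) * u x * e x ξ) * ψ ξ) (μ.prod ν) := by
    refine (hg.norm.mul_prod hψ.norm).mono' ?_ (Filter.Eventually.of_forall fun p => ?_)
    · exact ((continuous_conj.measurable.comp ((hgm'.comp measurable_fst).mul he)).mul
        (hψm.comp measurable_snd)).aestronglyMeasurable
    · obtain ⟨x, ξ⟩ := p
      have : ‖conj ((g x : ℂ) * u x * e x ξ) * ψ ξ‖ = ‖(g x : ℂ) * u x‖ * ‖e x ξ‖ * ‖ψ ξ‖ := by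
        rw [norm_mul, RCLike.norm_conj, norm_mul]
      change ‖conj ((g x : ℂ) * u x * e x ξ) * ψ ξ‖ ≤ ‖(g x : ℂ) * u x‖ * ‖ψ ξ‖
      rw [this]
      gcongr
      exact mul_le_of_le_one_right (norm_nonneg _) (he1 _ _)
  have key : ∫ x, ((g x * ‖u x‖ ^ 2 : ℝ) : ℂ) ∂μ =
      ∫ ξ, conj (∫ x, (g x : ℂ) * u x * e x ξ ∂μ) * ψ ξ ∂ν := by
    calc ∫ x, ((g x * ‖u x‖ ^ 2 : ℝ) : ℂ) ∂μ
        = ∫ x, ∫ ξ, conj ((g x : ℂ) * u x * e x ξ) * ψ ξ ∂ν ∂μ := by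
          congr with x
          have : ∀ ξ, conj ((g x : ℂ) * u x * e x ξ) * ψ ξ =
              conj ((g x : ℂ) * u x) * (conj (e x ξ) * ψ ξ) := fun ξ => by
            rw [map_mul]; ring
          simp_rw [this]
          rw [integral_const_mul, ← hu, map_mul, mul_assoc, mul_comm (conj (u x)), mul_conj,
            normSq_eq_norm_sq, conj_ofReal]
          push_cast
          rfl
      _ = ∫ ξ, ∫ x, conj ((g x : ℂ) * u x * e x ξ) * ψ ξ ∂μ ∂ν := integral_integral_swap hprod
      _ = _ := by
          congr with ξ
          rw [integral_mul_const, ← integral_conj]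
  calc ∫⁻ x, g x * ‖u x‖ₑ ^ 2 ∂μ = ∫⁻ x, ‖((g x * ‖u x‖ ^ 2 : ℝ) : ℂ)‖ₑ ∂μ := by
        refine lintegral_congr fun x => ?_
        rw [← ofReal_norm (_ : ℂ), ← ofReal_norm (_ : ℂ), norm_real,
          Real.norm_of_nonneg (by positivity), ENNReal.ofReal_mul (by positivity),
          ENNReal.ofReal_coe_nnreal, ENNReal.ofReal_pow (norm_nonneg _)]
    _ = ‖∫ x, ((g x * ‖u x‖ ^ 2 : ℝ) : ℂ) ∂μ‖ₑ := by
        rw [integral_complex_ofReal, ← ofReal_norm, norm_real, Real.norm_of_nonneg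
          (integral_nonneg fun x => by positivity), ofReal_integral_eq_lintegral_ofReal]
        · refine lintegral_congr fun x => ?_
          rw [← ofReal_norm, norm_real, Real.norm_of_nonneg (by positivity)]
        · exact hint.re
        · exact Filter.Eventually.of_forall fun x => by positivity
    _ ≤ _ := by
        rw [key]
        refine enorm_integral_conj_mul_le_sqrt ?_ hψm
        have : Measurable fun p : Ξ × X => (g p.2 : ℂ) * u p.2 * e p.2 p.1 :=
          (hgm'.comp measurable_snd).mul (he.comp measurable_swap)
        exact (this.stronglyMeasurable.integral_prod_right').measurable

/-- The regularised half-wave evolution of the frequency-side datum `ψ`. -/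
def waveExt (ψ : Sp → ℂ) (t : ℝ) (x : Sp) : ℂ := ∫ ξ, conj (waveChar t x ξ) * ψ ξ ∂freqMeasure

section waveExt

variable {ψ : Sp → ℂ}

theorem measurable_waveExt (hψm : Measurable ψ) : Measurable (Function.uncurry (waveExt ψ)) := by
  have h : Measurable fun p : (ℝ × Sp) × Sp => conj (waveChar p.1.1 p.1.2 p.2) * ψ p.2 := by
    refine (continuous_conj.measurable.comp ?_).mul (hψm.comp measurable_snd)
    exact (continuous_waveChar.comp (f := fun p : (ℝ × Sp) × Sp => (p.1.1, p.1.2, p.2))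
      (by fun_prop)).measurable
  exact (h.stronglyMeasurable.integral_prod_right').measurable

theorem measurable_waveExt_slice (hψm : Measurable ψ) (t : ℝ) : Measurable (waveExt ψ t) :=
  (measurable_waveExt hψm).of_uncurry_left

theorem norm_waveExt_le (t : ℝ) (x : Sp) : ‖waveExt ψ t x‖ ≤ ∫ ξ, ‖ψ ξ‖ ∂freqMeasure :=
  (norm_integral_le_integral_norm _).trans_eq (by simp)

theorem lintegral_enorm_waveExt_sq_le (hψm : Measurable ψ) (hψ : Integrable ψ freqMeasure)
    (t : ℝ) :
    ∫⁻ x, ‖waveExt ψ t x‖ₑ ^ 2 ≤ energyConst * ∫⁻ ξ, ‖ψ ξ‖ₑ ^ 2 ∂freqMeasure := by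
  have hm : Measurable (waveExt ψ t) := measurable_waveExt_slice hψm t
  have hR (R : ℕ) : ∫⁻ x in Metric.closedBall 0 R, ‖waveExt ψ t x‖ₑ ^ 2 ≤
      energyConst * ∫⁻ ξ, ‖ψ ξ‖ₑ ^ 2 ∂freqMeasure := by
    set B : Set Sp := Metric.closedBall 0 R
    have hB : MeasurableSet B := measurableSet_closedBall
    set g : Sp → ℝ≥0 := B.indicator 1 with hgdef
    have hgm : Measurable g := measurable_one.indicator hB
    have hgu : (fun x => (g x : ℂ) * waveExt ψ t x) = B.indicator (waveExt ψ t) := by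
      ext x
      by_cases h : x ∈ B <;> simp [hgdef, h]
    have hBfin : volume B ≠ ⊤ := measure_closedBall_lt_top.ne
    have hg : Integrable (fun x => (g x : ℂ) * waveExt ψ t x) := by
      rw [hgu, integrable_indicator_iff hB]
      exact Measure.integrableOn_of_bounded hBfin hm.aestronglyMeasurable
        (Filter.Eventually.of_forall fun x => norm_waveExt_le t x)
    have hS : ∫⁻ x, g x * ‖waveExt ψ t x‖ₑ ^ 2 = ∫⁻ x in B, ‖waveExt ψ t x‖ₑ ^ 2 := by
      rw [← lintegral_indicator hB]
      refine lintegral_congr fun x => ?_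
      by_cases h : x ∈ B <;> simp [hgdef, h]
    have hw : Measurable (Function.uncurry (waveChar t)) :=
      (continuous_waveChar.comp (f := fun p : Sp × Sp => (t, p.1, p.2)) (by fun_prop)).measurable
    have h := lintegral_mul_enorm_sq_le_of_pairing (μ := volume) (ν := freqMeasure)
      (e := waveChar t) hw (by simp) hψm hψ (u := waveExt ψ t) (fun _ => rfl) hm hgm hg
    rw [hS] at h
    refine ENNReal.le_mul_of_le_sqrt_mul_sqrt ?_ (h.trans ?_)
    · refine ne_top_of_le_ne_top (ENNReal.mul_ne_top
        (ENNReal.pow_ne_top ENNReal.ofReal_ne_top) hBfin)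
        ((setLIntegral_mono measurable_const fun x _ => ?_).trans_eq
          (setLIntegral_const B (ENNReal.ofReal (∫ ξ, ‖ψ ξ‖ ∂freqMeasure) ^ 2)))
      rw [← ofReal_norm]
      gcongr
      exact norm_waveExt_le t x
    · gcongr
      refine (lintegral_enorm_sliceTransform_sq_le (φ := fun x => (g x : ℂ) * waveExt ψ t x)
        ?_ hg t).trans_eq ?_
      · rw [hgu]; exact hm.indicator hB
      · rw [← hS]
        congr 1
        refine lintegral_congr fun x => ?_
        by_cases h : x ∈ B <;> simp [hgdef, h]
  rw [← setLIntegral_univ, ← Metric.iUnion_closedBall_nat (0 : Sp),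
    setLIntegral_iUnion_of_directed]
  · exact iSup_le hR
  · exact (monotone_nat_of_le_succ fun n =>
      Metric.closedBall_subset_closedBall (by simp)).directed_le

end waveExt

/-- The weight `w⁻⁴ a⁴` restricted to the dyadic range `4 ^ n * w < a ≤ 4 ^ (n + 1) * w`. -/
def levelWeight (w : ℝ≥0) (n : ℤ) (a : ℝ≥0) : ℝ≥0 :=
  if 4 ^ n * w < a ∧ a ≤ 4 ^ (n + 1) * w then w⁻¹ ^ 4 * a ^ 4 else 0

/-- The superlevel slice on which `levelWeight` is supported. -/
def levelSet (v : Sp → ℂ) (w : ℝ≥0) (n : ℤ) : Set Sp :=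
  {x | 4 ^ n * w < ‖v x‖₊ ∧ ‖v x‖₊ ≤ 4 ^ (n + 1) * w}

/-- The coefficient attached to a level slice. -/
def levelCoeff (v : Sp → ℂ) (w : ℝ≥0) (n : ℤ) : ℝ≥0 :=
  1024 * w * NNReal.sqrt ((((4 : ℝ≥0) ^ n : ℝ≥0) : ℝ≥0∞) ^ 6 * volume (levelSet v w n)).toNNReal

@[simp]
theorem levelWeight_zero (n : ℤ) (a : ℝ≥0) : levelWeight 0 n a = 0 := by
  simp [levelWeight]

theorem measurable_levelWeight (n : ℤ) :
    Measurable fun p : ℝ≥0 × ℝ≥0 => levelWeight p.1 n p.2 := by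
  unfold levelWeight
  refine Measurable.ite ?_ (by fun_prop) measurable_const
  exact (measurableSet_lt (by fun_prop) (by fun_prop)).inter
    (measurableSet_le (by fun_prop) (by fun_prop))

section slice

variable {v : Sp → ℂ} {w : ℝ≥0} {n : ℤ}

theorem levelWeight_eq_indicator (x : Sp) :
    levelWeight w n ‖v x‖₊ = (levelSet v w n).indicator (fun x => w⁻¹ ^ 4 * ‖v x‖₊ ^ 4) x := by
  classical
  rw [Set.indicator_apply, levelWeight]
  congr

theorem measurableSet_levelSet (hv : Measurable v) : MeasurableSet (levelSet v w n) :=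
  (measurableSet_lt (f := fun _ => 4 ^ n * w) measurable_const hv.nnnorm).inter
    (measurableSet_le (g := fun _ => 4 ^ (n + 1) * w) hv.nnnorm measurable_const)

theorem levelCoeff_le (hv : Measurable v) (hw : w ≠ 0 → ∫⁻ x, ‖v x‖ₑ ^ 6 = (w : ℝ≥0∞) ^ 6) :
    w ≠ 0 → (((4 : ℝ≥0) ^ n : ℝ≥0) : ℝ≥0∞) ^ 6 * volume (levelSet v w n) ≤ 1 := by
  intro h0
  set l : ℝ≥0 := (4 : ℝ≥0) ^ n
  have h1 : ((l * w : ℝ≥0) : ℝ≥0∞) ^ 6 * volume (levelSet v w n) ≤ (w : ℝ≥0∞) ^ 6 := by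
    rw [← hw h0]
    refine le_trans ?_ (mul_meas_ge_le_lintegral (hv.enorm.pow_const 6) (((l * w : ℝ≥0) : ℝ≥0∞) ^ 6))
    gcongr
    intro x hx
    have : ((l * w : ℝ≥0) : ℝ≥0∞) ≤ ‖v x‖ₑ := by
      rw [enorm_eq_nnnorm]
      exact_mod_cast hx.1.le
    show ((l * w : ℝ≥0) : ℝ≥0∞) ^ 6 ≤ ‖v x‖ₑ ^ 6
    gcongr
  have hw6 : (w : ℝ≥0∞) ^ 6 ≠ 0 := by simpa using h0
  have hw6' : (w : ℝ≥0∞) ^ 6 ≠ ⊤ := by simp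
  rw [ENNReal.coe_mul, mul_pow, mul_comm ((l : ℝ≥0∞) ^ 6), mul_assoc] at h1
  rw [← ENNReal.mul_le_mul_iff_right hw6 hw6', mul_one]
  exact h1

theorem coe_toNNReal_level (hv : Measurable v)
    (hw : w ≠ 0 → ∫⁻ x, ‖v x‖ₑ ^ 6 = (w : ℝ≥0∞) ^ 6) (h0 : w ≠ 0) :
    (((((4 : ℝ≥0) ^ n : ℝ≥0) : ℝ≥0∞) ^ 6 * volume (levelSet v w n)).toNNReal : ℝ≥0∞) =
      (((4 : ℝ≥0) ^ n : ℝ≥0) : ℝ≥0∞) ^ 6 * volume (levelSet v w n) :=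
  ENNReal.coe_toNNReal (ne_top_of_le_ne_top (by simp) (levelCoeff_le hv hw h0))

theorem enorm_levelWeight_mul_le (x : Sp) :
    ‖(levelWeight w n ‖v x‖₊ : ℂ) * v x‖ₑ ≤ (levelSet v w n).indicator
      (fun _ => ((1024 * ((4 : ℝ≥0) ^ n) ^ 5 * w : ℝ≥0) : ℝ≥0∞)) x := by
  have h1 : ‖(levelWeight w n ‖v x‖₊ : ℂ) * v x‖ₑ = ((levelWeight w n ‖v x‖₊ * ‖v x‖₊ : ℝ≥0) : ℝ≥0∞) := by
    simp [enorm_eq_nnnorm]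
  rw [h1, levelWeight_eq_indicator]
  by_cases hx : x ∈ levelSet v w n
  · rw [Set.indicator_of_mem hx, Set.indicator_of_mem hx]
    refine ENNReal.coe_le_coe.2 ?_
    have h2 : ‖v x‖₊ ≤ 4 * 4 ^ n * w := by
      refine hx.2.trans_eq ?_
      rw [zpow_add₀ (by norm_num), zpow_one, mul_comm (4 : ℝ≥0)]
    have h0 : w ≠ 0 := by
      rintro rfl
      simpa using hx.1.trans_le hx.2
    calc w⁻¹ ^ 4 * ‖v x‖₊ ^ 4 * ‖v x‖₊ = w⁻¹ ^ 4 * ‖v x‖₊ ^ 5 := by ring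
      _ ≤ w⁻¹ ^ 4 * (4 * 4 ^ n * w) ^ 5 := by gcongr
      _ = _ := by field_simp; ring
  · simp [hx]

theorem lintegral_enorm_levelWeight_le (hv : Measurable v)
    (hw : w ≠ 0 → ∫⁻ x, ‖v x‖ₑ ^ 6 = (w : ℝ≥0∞) ^ 6) :
    ∫⁻ x, ‖(levelWeight w n ‖v x‖₊ : ℂ) * v x‖ₑ ≤
      ((((4 : ℝ≥0) ^ n)⁻¹ : ℝ≥0) : ℝ≥0∞) * levelCoeff v w n := by
  by_cases h0 : w = 0
  · simp [h0]
  refine (lintegral_mono enorm_levelWeight_mul_le).trans ?_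
  rw [lintegral_indicator_const (measurableSet_levelSet hv), levelCoeff]
  have hp := coe_toNNReal_level (n := n) hv hw h0
  have hp1 := levelCoeff_le (n := n) hv hw h0
  rw [← hp] at hp1
  set p := ((((4 : ℝ≥0) ^ n : ℝ≥0) : ℝ≥0∞) ^ 6 * volume (levelSet v w n)).toNNReal
  have hp1' : p ≤ 1 := by exact_mod_cast hp1
  have hl : (4 : ℝ≥0) ^ n ≠ 0 := by positivity
  have hps : p ≤ NNReal.sqrt p := by
    rw [NNReal.le_sqrt_iff_sq_le, sq]
    exact mul_le_of_le_one_left zero_le hp1'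
  calc _ = ((((4 : ℝ≥0) ^ n)⁻¹ * (1024 * w) : ℝ≥0) : ℝ≥0∞) *
        ((((4 : ℝ≥0) ^ n : ℝ≥0) : ℝ≥0∞) ^ 6 * volume (levelSet v w n)) := by
        rw [← mul_assoc, ← ENNReal.coe_pow, ← ENNReal.coe_mul]
        congr 2
        field_simp
    _ = (((4 : ℝ≥0) ^ n)⁻¹ * (1024 * w) * p : ℝ≥0) := by
        rw [← hp]; push_cast; rfl
    _ ≤ (((4 : ℝ≥0) ^ n)⁻¹ * (1024 * w) * NNReal.sqrt p : ℝ≥0) := by gcongr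
    _ = _ := by rw [mul_assoc, ENNReal.coe_mul]

theorem lintegral_enorm_levelWeight_sq_le (hv : Measurable v)
    (hw : w ≠ 0 → ∫⁻ x, ‖v x‖ₑ ^ 6 = (w : ℝ≥0∞) ^ 6) :
    ∫⁻ x, ‖(levelWeight w n ‖v x‖₊ : ℂ) * v x‖ₑ ^ 2 ≤
      (((((4 : ℝ≥0) ^ n) ^ 2 : ℝ≥0) : ℝ≥0∞) * levelCoeff v w n) ^ 2 := by
  by_cases h0 : w = 0
  · simp [h0]
  calc _ ≤ ∫⁻ x, (levelSet v w n).indicator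
        (fun _ => ((1024 * ((4 : ℝ≥0) ^ n) ^ 5 * w : ℝ≥0) : ℝ≥0∞) ^ 2) x := by
        refine lintegral_mono fun x => ?_
        refine (pow_le_pow_left' (enorm_levelWeight_mul_le x) 2).trans_eq ?_
        by_cases hx : x ∈ levelSet v w n <;> simp [hx]
    _ = ((((4 : ℝ≥0) ^ n) ^ 2 * (1024 * w) : ℝ≥0) : ℝ≥0∞) ^ 2 *
        ((((4 : ℝ≥0) ^ n : ℝ≥0) : ℝ≥0∞) ^ 6 * volume (levelSet v w n)) := by
        rw [lintegral_indicator_const (measurableSet_levelSet hv), ← mul_assoc,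
          ← ENNReal.coe_pow, ← ENNReal.coe_pow, ← ENNReal.coe_pow, ← ENNReal.coe_mul]
        congr 2
        ring
    _ = _ := by
        rw [← coe_toNNReal_level hv hw h0, levelCoeff]
        set p := ((((4 : ℝ≥0) ^ n : ℝ≥0) : ℝ≥0∞) ^ 6 * volume (levelSet v w n)).toNNReal
        rw [← ENNReal.coe_pow, ← ENNReal.coe_mul, ← ENNReal.coe_mul, ← ENNReal.coe_pow]
        congr 1
        simp only [mul_pow, NNReal.sq_sqrt]
        ring

theorem levelCoeff_sq_le (hv : Measurable v)
    (hw : w ≠ 0 → ∫⁻ x, ‖v x‖ₑ ^ 6 = (w : ℝ≥0∞) ^ 6) :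
    (levelCoeff v w n : ℝ≥0∞) ^ 2 ≤
      1024 ^ 2 * ∫⁻ x, (levelWeight w n ‖v x‖₊ : ℝ≥0∞) * ‖v x‖ₑ ^ 2 := by
  by_cases h0 : w = 0
  · simp [h0, levelCoeff]
  calc (levelCoeff v w n : ℝ≥0∞) ^ 2 = 1024 ^ 2 * ((w : ℝ≥0∞) ^ 2 *
        ((((4 : ℝ≥0) ^ n : ℝ≥0) : ℝ≥0∞) ^ 6 * volume (levelSet v w n))) := by
        rw [← coe_toNNReal_level hv hw h0, levelCoeff]
        set p := ((((4 : ℝ≥0) ^ n : ℝ≥0) : ℝ≥0∞) ^ 6 * volume (levelSet v w n)).toNNReal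
        rw [← ENNReal.coe_pow, mul_pow, NNReal.sq_sqrt, mul_pow]
        push_cast
        ring
    _ = 1024 ^ 2 * ∫⁻ x, (levelSet v w n).indicator
        (fun _ => ((w ^ 2 * ((4 : ℝ≥0) ^ n) ^ 6 : ℝ≥0) : ℝ≥0∞)) x := by
        rw [lintegral_indicator_const (measurableSet_levelSet hv), ENNReal.coe_mul,
          ENNReal.coe_pow, ENNReal.coe_pow, mul_assoc ((w : ℝ≥0∞) ^ 2)]
    _ ≤ _ := by
        gcongr with x
        refine Set.indicator_apply_le' (fun hx => ?_) fun _ => zero_le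
        rw [levelWeight_eq_indicator, Set.indicator_of_mem hx, enorm_eq_nnnorm, ← ENNReal.coe_pow,
          ← ENNReal.coe_mul]
        refine ENNReal.coe_le_coe.2 ?_
        calc w ^ 2 * ((4 : ℝ≥0) ^ n) ^ 6 = w⁻¹ ^ 4 * (4 ^ n * w) ^ 6 := by field_simp
          _ ≤ w⁻¹ ^ 4 * ‖v x‖₊ ^ 6 := by
            gcongr
            exact hx.1.le
          _ = _ := by ring

theorem lintegral_levelWeight_le (hw : w ≠ 0 → ∫⁻ x, ‖v x‖ₑ ^ 6 = (w : ℝ≥0∞) ^ 6) :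
    ∫⁻ x, (levelWeight w n ‖v x‖₊ : ℝ≥0∞) * ‖v x‖ₑ ^ 2 ≤ (w : ℝ≥0∞) ^ 2 := by
  by_cases h0 : w = 0
  · simp [h0]
  calc _ ≤ ∫⁻ x, ((w⁻¹ ^ 4 : ℝ≥0) : ℝ≥0∞) * ‖v x‖ₑ ^ 6 := by
        refine lintegral_mono fun x => ?_
        simp only [enorm_eq_nnnorm, ← ENNReal.coe_pow, ← ENNReal.coe_mul]
        refine ENNReal.coe_le_coe.2 ?_
        unfold levelWeight
        split_ifs
        · exact le_of_eq (by ring)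
        · simp
    _ = _ := by
        rw [lintegral_const_mul' _ _ ENNReal.coe_ne_top, hw h0, ← ENNReal.coe_pow,
          ← ENNReal.coe_mul, ← ENNReal.coe_pow]
        congr 1
        field_simp

theorem sq_le_tsum_lintegral_levelWeight (hv : Measurable v)
    (hw : w ≠ 0 → ∫⁻ x, ‖v x‖ₑ ^ 6 = (w : ℝ≥0∞) ^ 6) :
    (w : ℝ≥0∞) ^ 2 ≤ ∑' n : ℤ, ∫⁻ x, (levelWeight w n ‖v x‖₊ : ℝ≥0∞) * ‖v x‖ₑ ^ 2 := by
  by_cases h0 : w = 0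
  · simp [h0]
  have hm (n : ℤ) : Measurable fun x => (levelWeight w n ‖v x‖₊ : ℝ≥0∞) * ‖v x‖ₑ ^ 2 := by
    refine Measurable.mul ?_ (hv.enorm.pow_const 2)
    exact ((measurable_levelWeight n).comp (measurable_const.prodMk hv.nnnorm)).coe_nnreal_ennreal
  rw [← lintegral_tsum fun n => (hm n).aemeasurable]
  calc (w : ℝ≥0∞) ^ 2 = ∫⁻ x, ((w⁻¹ ^ 4 : ℝ≥0) : ℝ≥0∞) * ‖v x‖ₑ ^ 6 := by
        rw [lintegral_const_mul' _ _ ENNReal.coe_ne_top, hw h0]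
        simp only [← ENNReal.coe_pow, ← ENNReal.coe_mul]
        congr 1
        field_simp
    _ ≤ _ := by
        refine lintegral_mono fun x => ?_
        by_cases hx : v x = 0
        · simp [hx]
        obtain ⟨n, hn1, hn2⟩ := exists_mem_Ioc_zpow (y := (4 : ℝ))
          (x := ‖v x‖ / w) (by have := norm_pos_iff.2 hx; positivity) (by norm_num)
        have hwpos : (0 : ℝ) < w := by positivity
        rw [lt_div_iff₀ hwpos] at hn1
        rw [div_le_iff₀ hwpos] at hn2
        refine le_trans ?_ (ENNReal.le_tsum n)
        simp only [enorm_eq_nnnorm, ← ENNReal.coe_pow, ← ENNReal.coe_mul]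
        refine ENNReal.coe_le_coe.2 ?_
        unfold levelWeight
        rw [if_pos ⟨by rw [← NNReal.coe_lt_coe]; exact_mod_cast hn1,
          by rw [← NNReal.coe_le_coe]; exact_mod_cast hn2⟩]
        exact le_of_eq (by ring)

end slice

theorem IsWaveAtom.integrable_uncurry {lam : ℝ} {c : ℝ → ℝ≥0} {F : ℝ → Sp → ℂ}
    (hF : IsWaveAtom lam c F) :
    Integrable (Function.uncurry F) ((volume : Measure ℝ).prod (volume : Measure Sp)) := by
  refine ⟨hF.measurable.aestronglyMeasurable, ?_⟩
  rw [hasFiniteIntegral_iff_enorm, lintegral_prod _ hF.measurable.enorm.aemeasurable]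
  calc ∫⁻ t, ∫⁻ x, ‖F t x‖ₑ ≤ ∫⁻ t, ENNReal.ofReal lam⁻¹ * c t := lintegral_mono hF.l1_le
    _ = ENNReal.ofReal lam⁻¹ * ∫⁻ t, c t := lintegral_const_mul' _ _ ENNReal.ofReal_ne_top
    _ < ⊤ := ENNReal.mul_lt_top ENNReal.ofReal_lt_top hF.coeff_ne_top.lt_top

theorem IsWaveAtom.integral_prod_mul_waveChar {lam : ℝ} {c : ℝ → ℝ≥0} {F : ℝ → Sp → ℂ}
    (hF : IsWaveAtom lam c F) (ξ : Sp) :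
    Integrable (fun p : ℝ × Sp => F p.1 p.2 * waveChar p.1 p.2 ξ) (volume.prod volume) ∧
    ∫ p : ℝ × Sp, F p.1 p.2 * waveChar p.1 p.2 ξ ∂(volume.prod volume) = waveTransform F ξ := by
  have hi : Integrable (fun p : ℝ × Sp => F p.1 p.2 * waveChar p.1 p.2 ξ)
      (volume.prod volume) := by
    refine hF.integrable_uncurry.mul_bdd (c := 1) ?_ (Filter.Eventually.of_forall fun p => by simp)
    exact (continuous_waveChar.comp (f := fun p : ℝ × Sp => (p.1, p.2, ξ))
      (by fun_prop)).aestronglyMeasurable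
  exact ⟨hi, integral_prod _ hi⟩

theorem enorm_waveForm_sum_self {I : Finset ℤ} {lam : ℤ → ℝ} {c : ℤ → ℝ → ℝ≥0}
    {G : ℤ → ℝ → Sp → ℂ} (hG : ∀ n ∈ I, IsWaveAtom (lam n) (c n) (G n)) :
    ‖waveForm (fun t x => ∑ n ∈ I, G n t x) (fun t x => ∑ n ∈ I, G n t x)‖ₑ =
      ∫⁻ ξ, ‖waveTransform (fun t x => ∑ n ∈ I, G n t x) ξ‖ₑ ^ 2 ∂freqMeasure := by
  refine (lintegral_enorm_sq_eq ?_).symm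
  rw [waveTransform_sum hG]
  exact memLp_finsetSum I fun n hn => (hG n hn).memLp_waveTransform

/-- `w` is the spatial `L⁶` norm of `u`, cut off to the times where it is nonzero. -/
structure IsSliceNorm (u : ℝ → Sp → ℂ) (w : ℝ → ℝ≥0) : Prop where
  measurable : Measurable (Function.uncurry u)
  measurable_norm : Measurable w
  eq_of_ne_zero : ∀ t, w t ≠ 0 → ∫⁻ x, ‖u t x‖ₑ ^ 6 = (w t : ℝ≥0∞) ^ 6
  lintegral_ne_top : ∫⁻ t, w t ≠ ⊤

/-- The constant of the endpoint estimate. -/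
def endpointConst : ℝ≥0∞ := orthConst * 1024 ^ 2

namespace IsSliceNorm

variable {u : ℝ → Sp → ℂ} {w : ℝ → ℝ≥0}

theorem measurable_slice (h : IsSliceNorm u w) (t : ℝ) : Measurable (u t) :=
  h.measurable.of_uncurry_left

theorem measurable_weight (h : IsSliceNorm u w) (n : ℤ) :
    Measurable fun p : ℝ × Sp => levelWeight (w p.1) n ‖u p.1 p.2‖₊ :=
  (measurable_levelWeight n).comp
    ((h.measurable_norm.comp measurable_fst).prodMk h.measurable.nnnorm)

theorem measurable_levelCoeff (h : IsSliceNorm u w) (n : ℤ) :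
    Measurable fun t => levelCoeff (u t) (w t) n := by
  have hw : Measurable fun p : ℝ × Sp => w p.1 := h.measurable_norm.comp measurable_fst
  have hu : Measurable fun p : ℝ × Sp => ‖u p.1 p.2‖₊ := h.measurable.nnnorm
  have hS : MeasurableSet {p : ℝ × Sp | 4 ^ n * w p.1 < ‖u p.1 p.2‖₊ ∧
      ‖u p.1 p.2‖₊ ≤ 4 ^ (n + 1) * w p.1} :=
    (measurableSet_lt (f := fun p : ℝ × Sp => 4 ^ n * w p.1) (hw.const_mul _) hu).inter
      (measurableSet_le (g := fun p : ℝ × Sp => 4 ^ (n + 1) * w p.1) hu (hw.const_mul _))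
  have hV : Measurable fun t => volume (levelSet (u t) (w t) n) :=
    measurable_measure_prodMk_left hS
  unfold levelCoeff
  exact (h.measurable_norm.const_mul 1024).mul
    (NNReal.continuous_sqrt.measurable.comp (hV.const_mul _).ennreal_toNNReal)

theorem isWaveAtom (h : IsSliceNorm u w) (n : ℤ) :
    IsWaveAtom (4 ^ n) (fun t => levelCoeff (u t) (w t) n)
      (fun t x => (levelWeight (w t) n ‖u t x‖₊ : ℂ) * u t x) where
  measurable := (Complex.measurable_ofReal.comp
    (measurable_coe_nnreal_real.comp (h.measurable_weight n))).mul h.measurable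
  measurable_coeff := h.measurable_levelCoeff n
  coeff_ne_top := by
    refine ne_top_of_le_ne_top (ENNReal.mul_ne_top (b := ∫⁻ t, w t) (a := 1024) (by simp)
      h.lintegral_ne_top) ?_
    rw [← lintegral_const_mul' _ _ (by simp)]
    refine lintegral_mono fun t => ?_
    by_cases h0 : w t = 0
    · simp [levelCoeff, h0]
    have h1 := levelCoeff_le (n := n) (h.measurable_slice t) (h.eq_of_ne_zero t) h0
    rw [levelCoeff, show (1024 : ℝ≥0∞) * w t = ((1024 * w t * 1 : ℝ≥0) : ℝ≥0∞) by simp]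
    refine ENNReal.coe_le_coe.2 ?_
    gcongr
    rw [NNReal.sqrt_le_one]
    simpa using ENNReal.toNNReal_mono (by simp) h1
  l1_le t := by
    refine (lintegral_enorm_levelWeight_le (h.measurable_slice t) (h.eq_of_ne_zero t)).trans_eq ?_
    congr 1
    rw [← ENNReal.ofReal_coe_nnreal]
    simp
  l2_le t := by
    refine (lintegral_enorm_levelWeight_sq_le (h.measurable_slice t)
      (h.eq_of_ne_zero t)).trans_eq ?_
    congr 2
    rw [← ENNReal.ofReal_coe_nnreal]
    simp

theorem measurable_levelMass (h : IsSliceNorm u w) (n : ℤ) :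
    Measurable fun p : ℝ × Sp => (levelWeight (w p.1) n ‖u p.1 p.2‖₊ : ℝ≥0∞) *
      ‖u p.1 p.2‖ₑ ^ 2 :=
  (h.measurable_weight n).coe_nnreal_ennreal.mul (h.measurable.enorm.pow_const 2)

theorem sum_levelMass_le {ψ : Sp → ℂ} (hψm : Measurable ψ) (hψ : Integrable ψ freqMeasure)
    (h : IsSliceNorm (waveExt ψ) w) {R : ℝ} (hR : ∀ t, R < |t| → w t = 0)
    (hw2 : ∫⁻ t, (w t : ℝ≥0∞) ^ 2 ≠ ⊤) (I : Finset ℤ) :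
    ∑ n ∈ I, ∫⁻ t, ∫⁻ x, (levelWeight (w t) n ‖waveExt ψ t x‖₊ : ℝ≥0∞) * ‖waveExt ψ t x‖ₑ ^ 2 ≤
      endpointConst * ∫⁻ ξ, ‖ψ ξ‖ₑ ^ 2 ∂freqMeasure := by
  set u := waveExt ψ with hu
  set S : ℤ → ℝ≥0∞ := fun n =>
    ∫⁻ t, ∫⁻ x, (levelWeight (w t) n ‖u t x‖₊ : ℝ≥0∞) * ‖u t x‖ₑ ^ 2 with hS
  change ∑ n ∈ I, S n ≤ _
  have hfin : ∑ n ∈ I, S n ≠ ⊤ := by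
    refine ENNReal.sum_ne_top.2 fun n _ => ne_top_of_le_ne_top hw2 ?_
    exact lintegral_mono fun t => lintegral_levelWeight_le (h.eq_of_ne_zero t)
  refine ENNReal.le_mul_of_le_sqrt_mul_sqrt hfin ?_
  set g : ℝ × Sp → ℝ≥0 := fun p => ∑ n ∈ I, levelWeight (w p.1) n ‖u p.1 p.2‖₊ with hg
  have hgm : Measurable g := Finset.measurable_sum I fun n _ => h.measurable_weight n
  have hgu (p : ℝ × Sp) : (g p : ℂ) * u p.1 p.2 =
      ∑ n ∈ I, (levelWeight (w p.1) n ‖u p.1 p.2‖₊ : ℂ) * u p.1 p.2 := by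
    simp [hg, Finset.sum_mul]
  have hpair := lintegral_mul_enorm_sq_le_of_pairing (μ := (volume : Measure ℝ).prod
    (volume : Measure Sp)) (ν := freqMeasure) (e := fun p ξ => waveChar p.1 p.2 ξ)
    (ψ := ψ) (u := fun p => u p.1 p.2) (g := g)
    (continuous_waveChar.comp (f := fun p : (ℝ × Sp) × Sp => (p.1.1, p.1.2, p.2))
      (by fun_prop)).measurable (fun p ξ => by simp) hψm hψ (fun p => rfl) h.measurable hgm
    (by
      simp_rw [hgu]
      exact integrable_finsetSum I fun n _ => (h.isWaveAtom n).integrable_uncurry)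
  have hL : ∫⁻ p : ℝ × Sp, (g p : ℝ≥0∞) * ‖u p.1 p.2‖ₑ ^ 2 ∂(volume.prod volume) =
      ∑ n ∈ I, S n := by
    simp_rw [hg, ENNReal.ofNNReal_finsetSum, Finset.sum_mul]
    rw [lintegral_finsetSum I fun n _ => h.measurable_levelMass n]
    exact Finset.sum_congr rfl fun n _ => lintegral_prod _ (h.measurable_levelMass n).aemeasurable
  have hT (ξ : Sp) : ∫ p : ℝ × Sp, (g p : ℂ) * u p.1 p.2 * waveChar p.1 p.2 ξ
      ∂(volume.prod volume) = waveTransform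
        (fun t x => ∑ n ∈ I, (levelWeight (w t) n ‖u t x‖₊ : ℂ) * u t x) ξ := by
    simp_rw [hgu, Finset.sum_mul]
    rw [integral_finsetSum I fun n _ => ((h.isWaveAtom n).integral_prod_mul_waveChar ξ).1,
      waveTransform_sum fun n _ => h.isWaveAtom n]
    exact Finset.sum_congr rfl fun n _ => ((h.isWaveAtom n).integral_prod_mul_waveChar ξ).2
  rw [hL] at hpair
  simp_rw [hT] at hpair
  rw [← enorm_waveForm_sum_self fun n _ => h.isWaveAtom n] at hpair
  refine hpair.trans ?_
  gcongr
  refine (enorm_waveForm_sum_self_le (R := R) (fun n _ => h.isWaveAtom n) fun n t ht => ?_).trans ?_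
  · ext x
    simp [hR t ht]
  rw [endpointConst, mul_assoc]
  refine mul_le_mul_right ?_ _
  rw [Finset.mul_sum]
  refine Finset.sum_le_sum fun n _ => ?_
  rw [hS, ← lintegral_const_mul' _ _ (by simp)]
  exact lintegral_mono fun t => levelCoeff_sq_le (h.measurable_slice t) (h.eq_of_ne_zero t)

theorem lintegral_sq_le {ψ : Sp → ℂ} (hψm : Measurable ψ) (hψ : Integrable ψ freqMeasure)
    (h : IsSliceNorm (waveExt ψ) w) {R : ℝ} (hR : ∀ t, R < |t| → w t = 0)
    (hw2 : ∫⁻ t, (w t : ℝ≥0∞) ^ 2 ≠ ⊤) :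
    ∫⁻ t, (w t : ℝ≥0∞) ^ 2 ≤ endpointConst * ∫⁻ ξ, ‖ψ ξ‖ₑ ^ 2 ∂freqMeasure := by
  calc _ ≤ ∫⁻ t, ∑' n : ℤ, ∫⁻ x, (levelWeight (w t) n ‖waveExt ψ t x‖₊ : ℝ≥0∞) *
        ‖waveExt ψ t x‖ₑ ^ 2 :=
        lintegral_mono fun t => sq_le_tsum_lintegral_levelWeight (h.measurable_slice t)
          (h.eq_of_ne_zero t)
    _ = ∑' n : ℤ, ∫⁻ t, ∫⁻ x, (levelWeight (w t) n ‖waveExt ψ t x‖₊ : ℝ≥0∞) *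
        ‖waveExt ψ t x‖ₑ ^ 2 :=
        lintegral_tsum fun n => (h.measurable_levelMass n).lintegral_prod_right'.aemeasurable
    _ ≤ _ := by
        rw [ENNReal.tsum_eq_iSup_sum]
        exact iSup_le fun I => h.sum_levelMass_le hψm hψ hR hw2 I

end IsSliceNorm

theorem endpointConst_ne_top : endpointConst ≠ ⊤ :=
  ENNReal.mul_ne_top orthConst_ne_top (by simp)

/-- The endpoint `L²_t L⁶_x` estimate for the regularised evolution. -/
theorem lintegral_waveExt_le {ψ : Sp → ℂ} (hψm : Measurable ψ) (hψ : Integrable ψ freqMeasure)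
    (hψ2 : ∫⁻ ξ, ‖ψ ξ‖ₑ ^ 2 ∂freqMeasure ≠ ⊤) :
    ∫⁻ t, (∫⁻ x, ‖waveExt ψ t x‖ₑ ^ 6) ^ (1 / 3 : ℝ) ≤
      endpointConst * ∫⁻ ξ, ‖ψ ξ‖ₑ ^ 2 ∂freqMeasure := by
  set W : ℝ → ℝ≥0∞ := fun t => ∫⁻ x, ‖waveExt ψ t x‖ₑ ^ 6 with hW
  have hWm : Measurable W := ((measurable_waveExt hψm).enorm.pow_const 6).lintegral_prod_right'
  set B : ℝ≥0 := (ENNReal.ofReal (∫ ξ, ‖ψ ξ‖ ∂freqMeasure) ^ 4 *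
    (energyConst * ∫⁻ ξ, ‖ψ ξ‖ₑ ^ 2 ∂freqMeasure)).toNNReal with hB
  have hWB (t : ℝ) : W t ≤ B := by
    rw [hB, ENNReal.coe_toNNReal (ENNReal.mul_ne_top (by simp)
      (ENNReal.mul_ne_top energyConst_ne_top hψ2))]
    refine le_trans ?_ (mul_le_mul_right (lintegral_enorm_waveExt_sq_le hψm hψ t) _)
    rw [← lintegral_const_mul' _ _ (by simp)]
    refine lintegral_mono fun x => ?_
    rw [show ‖waveExt ψ t x‖ₑ ^ 6 = ‖waveExt ψ t x‖ₑ ^ 4 * ‖waveExt ψ t x‖ₑ ^ 2 by ring]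
    gcongr
    rw [← ofReal_norm]
    exact ENNReal.ofReal_le_ofReal (norm_waveExt_le t x)
  have hWt (t : ℝ) : W t ≠ ⊤ := ne_top_of_le_ne_top (by simp) (hWB t)
  set v : ℝ → ℝ≥0 := fun t => (W t).toNNReal ^ (1 / 6 : ℝ) with hv
  have hvm : Measurable v := hWm.ennreal_toNNReal.pow_const _
  have hvB (t : ℝ) : v t ≤ B ^ (1 / 6 : ℝ) := by
    refine NNReal.rpow_le_rpow ?_ (by norm_num)
    simpa using ENNReal.toNNReal_mono (by simp) (hWB t)
  have hv2 (t : ℝ) : (v t : ℝ≥0∞) ^ 2 = W t ^ (1 / 3 : ℝ) := by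
    rw [hv, ENNReal.coe_rpow_of_nonneg _ (by norm_num), ENNReal.coe_toNNReal (hWt t),
      ← ENNReal.rpow_two, ← ENNReal.rpow_mul]
    norm_num
  have hv6 (t : ℝ) : (v t : ℝ≥0∞) ^ 6 = W t := by
    rw [hv, ENNReal.coe_rpow_of_nonneg _ (by norm_num), ENNReal.coe_toNNReal (hWt t),
      ← ENNReal.rpow_natCast, ← ENNReal.rpow_mul]
    norm_num
  have key (R : ℕ) : ∫⁻ t in Set.Icc (-(R : ℝ)) R, W t ^ (1 / 3 : ℝ) ≤
      endpointConst * ∫⁻ ξ, ‖ψ ξ‖ₑ ^ 2 ∂freqMeasure := by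
    set J : Set ℝ := Set.Icc (-(R : ℝ)) R
    have hJ : MeasurableSet J := measurableSet_Icc
    have hJfin : volume J ≠ ⊤ := measure_Icc_lt_top.ne
    have hbound (C : ℝ≥0) (f : ℝ → ℝ≥0∞) (hf : ∀ t, f t ≤ C) : ∫⁻ t in J, f t ≠ ⊤ := by
      refine ne_top_of_le_ne_top ?_ (lintegral_mono (μ := volume.restrict J) hf)
      simpa using ENNReal.mul_ne_top (by simp) hJfin
    have h1 : ∫⁻ t, ((J.indicator v t : ℝ≥0) : ℝ≥0∞) = ∫⁻ t in J, (v t : ℝ≥0∞) := by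
      rw [← lintegral_indicator hJ]
      refine lintegral_congr fun t => ?_
      by_cases h : t ∈ J <;> simp [h]
    have hs : IsSliceNorm (waveExt ψ) (J.indicator v) :=
      { measurable := measurable_waveExt hψm
        measurable_norm := hvm.indicator hJ
        eq_of_ne_zero := fun t ht => by
          have htJ : t ∈ J := Set.mem_of_indicator_ne_zero ht
          rw [Set.indicator_of_mem htJ, hv6]
        lintegral_ne_top := by
          rw [h1]
          exact hbound _ _ fun t => ENNReal.coe_le_coe.2 (hvB t) }
    have h2 := lintegral_indicator_coe_sq hJ v
    have hle := hs.lintegral_sq_le hψm hψ (R := R) (fun t ht => by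
      refine Set.indicator_of_notMem (fun h => ?_) _
      exact absurd (abs_le.2 h) (not_le.2 ht)) (by
      rw [h2]
      refine hbound ((B ^ (1 / 6 : ℝ)) ^ 2) _ fun t => ?_
      rw [← ENNReal.coe_pow]
      exact ENNReal.coe_le_coe.2 (pow_le_pow_left' (hvB t) 2))
    rw [h2] at hle
    simpa only [hv2] using hle
  have hU : ⋃ R : ℕ, Set.Icc (-(R : ℝ)) R = Set.univ := by
    refine Set.eq_univ_of_forall fun t => ?_
    obtain ⟨R, hR⟩ := exists_nat_ge |t|
    exact Set.mem_iUnion.2 ⟨R, abs_le.1 hR⟩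
  rw [← setLIntegral_univ, ← hU, setLIntegral_iUnion_of_directed]
  · exact iSup_le key
  · refine Monotone.directed_le fun a b hab => Set.Icc_subset_Icc ?_ ?_
    · simpa using hab
    · simpa using hab

/-- The frequency datum, with respect to `freqMeasure`, of the half-wave evolution of `f`. -/
def freqDatum (f : Sp → ℂ) (ξ : Sp) : ℂ := (Real.exp (2 * Real.pi * ‖ξ‖) : ℂ) * 𝓕 f ξ

theorem halfWave_eq_waveExt (f : Sp → ℂ) : halfWave f = waveExt (freqDatum f) := by
  ext t x
  rw [halfWave, waveExt, freqMeasure,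
    integral_withDensity_eq_integral_toReal_smul (by fun_prop) (by simp)]
  congr with ξ
  rw [ENNReal.toReal_ofReal (by positivity), waveChar, ← Complex.exp_conj, freqDatum, real_smul]
  have h : ((Real.exp (-(2 * Real.pi * ‖ξ‖)) : ℝ) : ℂ) * ((Real.exp (2 * Real.pi * ‖ξ‖) : ℝ) : ℂ)
      = 1 := by
    rw [← ofReal_mul, ← Real.exp_add]
    simp
  have h2 : conj (-(2 * Real.pi * Complex.I * ((t * ‖ξ‖ + ⟪x, ξ⟫ : ℝ) : ℂ))) =
      2 * Real.pi * Complex.I * ((t * ‖ξ‖ + ⟪x, ξ⟫ : ℝ) : ℂ) := by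
    simp only [map_neg, map_mul, conj_ofReal, conj_I, map_ofNat]
    ring
  rw [h2]
  linear_combination (-(cexp (2 * Real.pi * Complex.I * ((t * ‖ξ‖ + ⟪x, ξ⟫ : ℝ) : ℂ))) * 𝓕 f ξ) * h

section schwartz

variable (f : SchwartzMap Sp ℂ)

theorem SchwartzMap.continuous_fourier_coe : Continuous (𝓕 (f : Sp → ℂ)) := by
  rw [← SchwartzMap.fourier_coe]
  exact (𝓕 f).continuous

theorem SchwartzMap.integrable_fourier_coe : Integrable (𝓕 (f : Sp → ℂ)) := by
  rw [← SchwartzMap.fourier_coe]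
  exact (𝓕 f).integrable

theorem measurable_freqDatum : Measurable (freqDatum f) := by
  have h := f.continuous_fourier_coe
  unfold freqDatum
  exact (Continuous.mul (by fun_prop) h).measurable

theorem integrable_freqDatum : Integrable (freqDatum f) freqMeasure := by
  rw [freqMeasure, integrable_withDensity_iff_integrable_smul' (by fun_prop) (by simp)]
  refine f.integrable_fourier_coe.congr (Filter.Eventually.of_forall fun ξ => ?_)
  beta_reduce
  rw [ENNReal.toReal_ofReal (by positivity), freqDatum, real_smul, ← mul_assoc, ← ofReal_mul,
    ← Real.exp_add]
  simp

theorem lintegral_enorm_fourier_sq :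
    ∫⁻ ξ, ‖𝓕 (f : Sp → ℂ) ξ‖ₑ ^ 2 = eLpNorm f 2 volume ^ 2 := by
  have h1 (g : SchwartzMap Sp ℂ) : ∫⁻ ξ, ‖g ξ‖ₑ ^ 2 = eLpNorm g 2 volume ^ 2 := by
    have := eLpNorm_nnreal_pow_eq_lintegral (f := g) (μ := volume) (p := 2) (by norm_num)
    simpa using this.symm
  have h2 : eLpNorm (𝓕 f : SchwartzMap Sp ℂ) 2 volume = eLpNorm f 2 volume := by
    have := SchwartzMap.norm_fourier_toL2_eq f
    rw [SchwartzMap.norm_toLp, SchwartzMap.norm_toLp] at this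
    have h3 : eLpNorm (𝓕 f : SchwartzMap Sp ℂ) 2 volume ≠ ⊤ :=
      ((𝓕 f : SchwartzMap Sp ℂ).memLp 2 volume).eLpNorm_ne_top
    have h4 : eLpNorm f 2 volume ≠ ⊤ := (f.memLp 2 volume).eLpNorm_ne_top
    rwa [ENNReal.toReal_eq_toReal_iff' h3 h4] at this
  rw [← h2, ← h1, SchwartzMap.fourier_coe]

theorem lintegral_enorm_freqDatum_sq_le (hf : UnitFrequency f) :
    ∫⁻ ξ, ‖freqDatum f ξ‖ₑ ^ 2 ∂freqMeasure ≤
      ENNReal.ofReal (Real.exp (4 * Real.pi)) * eLpNorm f 2 volume ^ 2 := by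
  rw [← lintegral_enorm_fourier_sq, ← lintegral_const_mul' _ _ (by simp), freqMeasure,
    lintegral_withDensity_eq_lintegral_mul _ (by fun_prop)
      ((measurable_freqDatum f).enorm.pow_const 2)]
  refine lintegral_mono fun ξ => ?_
  by_cases h : 𝓕 (f : Sp → ℂ) ξ = 0
  · simp [freqDatum, h]
  have h2 := (hf ξ h).2
  have hD : ‖freqDatum f ξ‖ₑ =
      ENNReal.ofReal (Real.exp (2 * Real.pi * ‖ξ‖)) * ‖𝓕 (f : Sp → ℂ) ξ‖ₑ := by
    rw [freqDatum, enorm_mul, ← ofReal_norm ((Real.exp _ : ℝ) : ℂ), norm_real,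
      Real.norm_of_nonneg (by positivity)]
  rw [Pi.mul_apply, hD, mul_pow, ← mul_assoc, ← ENNReal.ofReal_pow (by positivity),
    ← ENNReal.ofReal_mul (by positivity)]
  gcongr
  rw [← Real.exp_nat_mul, ← Real.exp_add]
  refine Real.exp_le_exp.2 ?_
  have := Real.pi_pos
  push_cast
  nlinarith

end schwartz

/-- A Schwartz kernel whose Fourier transform equals one on the ball of radius `2`. -/
theorem exists_schwartz_fourier_eq_one :
    ∃ κ : SchwartzMap Sp ℂ, ∀ ξ : Sp, ‖ξ‖ ≤ 2 → 𝓕 (κ : Sp → ℂ) ξ = 1 := by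
  let b : ContDiffBump (0 : Sp) := ⟨2, 3, by norm_num, by norm_num⟩
  have hs : HasCompactSupport fun ξ => ((b ξ : ℝ) : ℂ) :=
    b.hasCompactSupport.comp_left ofReal_zero
  let χ : SchwartzMap Sp ℂ := hs.toSchwartzMap (ofRealCLM.contDiff.comp b.contDiff)
  refine ⟨𝓕⁻ χ, fun ξ hξ => ?_⟩
  rw [← SchwartzMap.fourier_coe, FourierTransform.fourier_fourierInv_eq]
  change ((b ξ : ℝ) : ℂ) = 1
  rw [b.one_of_mem_closedBall (by simpa using hξ), ofReal_one]

/-- Reproducing formula for unit-frequency waves. -/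
theorem halfWave_eq_integral_mul {κ : SchwartzMap Sp ℂ}
    (hκ : ∀ ξ : Sp, ‖ξ‖ ≤ 2 → 𝓕 (κ : Sp → ℂ) ξ = 1) (f : SchwartzMap Sp ℂ)
    (hf : UnitFrequency f) (t : ℝ) (x : Sp) :
    halfWave f t x = ∫ y, κ (x - y) * halfWave f t y := by
  have hE : Continuous fun p : Sp × Sp =>
      cexp (2 * Real.pi * Complex.I * ((t * ‖p.2‖ + ⟪p.1, p.2⟫ : ℝ) : ℂ)) := by fun_prop
  have hprod : Integrable (Function.uncurry fun y ξ : Sp => κ (x - y) *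
      (cexp (2 * Real.pi * Complex.I * ((t * ‖ξ‖ + ⟪y, ξ⟫ : ℝ) : ℂ)) * 𝓕 (f : Sp → ℂ) ξ))
      (volume.prod volume) := by
    have h0 : Integrable (fun p : Sp × Sp => κ (x - p.1) * 𝓕 (f : Sp → ℂ) p.2)
        (volume.prod volume) :=
      (κ.integrable.comp_sub_left x).mul_prod f.integrable_fourier_coe
    refine (h0.mul_bdd (c := 1) hE.aestronglyMeasurable (Filter.Eventually.of_forall fun p => ?_)).congr
      (Filter.Eventually.of_forall fun p => ?_)
    · rw [show 2 * Real.pi * Complex.I * ((t * ‖p.2‖ + ⟪p.1, p.2⟫ : ℝ) : ℂ) =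
        ((2 * Real.pi * (t * ‖p.2‖ + ⟪p.1, p.2⟫) : ℝ) : ℂ) * Complex.I by push_cast; ring,
        norm_exp_ofReal_mul_I]
    · simp only [Function.uncurry]
      ring
  calc halfWave f t x
      = ∫ ξ, ∫ y, κ (x - y) *
        (cexp (2 * Real.pi * Complex.I * ((t * ‖ξ‖ + ⟪y, ξ⟫ : ℝ) : ℂ)) * 𝓕 (f : Sp → ℂ) ξ) := by
        rw [halfWave]
        congr with ξ
        by_cases h : 𝓕 (f : Sp → ℂ) ξ = 0
        · simp [h]
        have h1 : ∫ y, cexp (-(2 * Real.pi * Complex.I * ((⟪y, ξ⟫ : ℝ) : ℂ))) * κ y = 1 := by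
          rw [← hκ ξ (hf ξ h).2, Real.fourier_eq']
          congr with y
          rw [smul_eq_mul]
          congr 2
          push_cast
          ring
        rw [← integral_sub_left_eq_self _ volume x] at h1
        rw [← mul_one (cexp _ * _), ← h1, ← integral_const_mul]
        congr with y
        rw [show ∀ a b c d : ℂ, a * b * (c * d) = d * ((a * c) * b) by intros; ring,
          ← Complex.exp_add]
        congr 3
        rw [inner_sub_left]
        push_cast
        ring
    _ = ∫ y, ∫ ξ, κ (x - y) *
        (cexp (2 * Real.pi * Complex.I * ((t * ‖ξ‖ + ⟪y, ξ⟫ : ℝ) : ℂ)) * 𝓕 (f : Sp → ℂ) ξ) :=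
        (integral_integral_swap hprod).symm
    _ = _ := by
        congr with y
        rw [integral_const_mul, halfWave]

theorem measurable_halfWave (f : SchwartzMap Sp ℂ) (t : ℝ) : Measurable (halfWave f t) := by
  rw [halfWave_eq_waveExt]
  exact measurable_waveExt_slice (measurable_freqDatum f) t

/-- Bernstein's inequality for unit-frequency waves. -/
theorem exists_eLpNorm_top_halfWave_le (p p' : ℝ≥0∞) [ENNReal.HolderTriple p' p 1] :
    ∃ C : ℝ≥0∞, C ≠ ⊤ ∧ ∀ f : SchwartzMap Sp ℂ, UnitFrequency f → ∀ t,
      eLpNorm (halfWave f t) ⊤ volume ≤ C * eLpNorm (halfWave f t) p volume := by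
  obtain ⟨κ, hκ⟩ := exists_schwartz_fourier_eq_one
  refine ⟨eLpNorm κ p' volume, (κ.memLp p' volume).eLpNorm_ne_top, fun f hf t => ?_⟩
  rw [eLpNorm_exponent_top]
  refine eLpNormEssSup_le_of_ae_enorm_bound (Filter.Eventually.of_forall fun x => ?_)
  rw [halfWave_eq_integral_mul hκ f hf]
  have hκx : eLpNorm (fun y => κ (x - y)) p' volume = eLpNorm κ p' volume :=
    eLpNorm_comp_measurePreserving κ.continuous.aestronglyMeasurable
      (Measure.measurePreserving_sub_left volume x)
  calc ‖∫ y, κ (x - y) * halfWave f t y‖ₑ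
      ≤ ∫⁻ y, ‖κ (x - y) * halfWave f t y‖ₑ := enorm_integral_le_lintegral_enorm _
    _ = eLpNorm ((fun y => κ (x - y)) • halfWave f t) 1 volume := by
        rw [eLpNorm_one_eq_lintegral_enorm]
        rfl
    _ ≤ _ := by
        rw [← hκx]
        exact eLpNorm_smul_le_mul_eLpNorm (measurable_halfWave f t).aestronglyMeasurable
          (κ.continuous.comp (continuous_const.sub continuous_id)).aestronglyMeasurable

/-- Logarithmic convexity of the Lebesgue norms. -/
theorem eLpNorm_le_rpow_mul_rpow {X : Type*} [MeasurableSpace X] {μ : Measure X} {v : X → ℂ}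
    (hv : AEStronglyMeasurable v μ) {p₀ p₁ r : ℝ≥0∞} {a b : ℝ} (ha : 0 ≤ a) (hb : 0 ≤ b)
    (hab : a + b = 1) (h : ENNReal.ofReal a / p₀ + ENNReal.ofReal b / p₁ = r⁻¹) :
    eLpNorm v r μ ≤ eLpNorm v p₀ μ ^ a * eLpNorm v p₁ μ ^ b := by
  rcases ha.eq_or_lt with rfl | ha
  · obtain rfl : b = 1 := by linarith
    obtain rfl : p₁ = r := by simpa using h
    simp
  rcases hb.eq_or_lt with rfl | hb
  · obtain rfl : a = 1 := by linarith
    obtain rfl : p₀ = r := by simpa using h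
    simp
  have ha0 : ENNReal.ofReal a ≠ 0 := by simpa using ha
  have hb0 : ENNReal.ofReal b ≠ 0 := by simpa using hb
  have : ENNReal.HolderTriple (p₀ / ENNReal.ofReal a) (p₁ / ENNReal.ofReal b) r := by
    constructor
    rw [ENNReal.inv_div (by simp) (by simp [ha]), ENNReal.inv_div (by simp) (by simp [hb]), h]
  calc eLpNorm v r μ = eLpNorm ((fun x => ‖v x‖ ^ a) • fun x => ‖v x‖ ^ b) r μ := by
        refine eLpNorm_congr_norm_ae (Filter.Eventually.of_forall fun x => ?_)
        rw [Pi.smul_apply', smul_eq_mul, ← Real.rpow_add_of_nonneg (norm_nonneg _) ha.le hb.le, hab,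
          Real.rpow_one, norm_norm]
    _ ≤ eLpNorm (fun x => ‖v x‖ ^ a) (p₀ / ENNReal.ofReal a) μ *
        eLpNorm (fun x => ‖v x‖ ^ b) (p₁ / ENNReal.ofReal b) μ :=
        eLpNorm_smul_le_mul_eLpNorm
          ((Real.continuous_rpow_const hb.le).comp_aestronglyMeasurable hv.norm)
          ((Real.continuous_rpow_const ha.le).comp_aestronglyMeasurable hv.norm)
    _ = _ := by
        rw [eLpNorm_norm_rpow _ ha, eLpNorm_norm_rpow _ hb,
          ENNReal.div_mul_cancel ha0 (by simp), ENNReal.div_mul_cancel hb0 (by simp)]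

theorem exists_eLpNorm_two_halfWave_le :
    ∃ C : ℝ≥0∞, C ≠ ⊤ ∧ ∀ f : SchwartzMap Sp ℂ, UnitFrequency f → ∀ t,
      eLpNorm (halfWave f t) 2 volume ≤ C * eLpNorm f 2 volume := by
  refine ⟨(energyConst * ENNReal.ofReal (Real.exp (4 * Real.pi))) ^ (1 / 2 : ℝ),
    ENNReal.rpow_ne_top_of_nonneg (by norm_num) (ENNReal.mul_ne_top energyConst_ne_top (by simp)),
    fun f hf t => ?_⟩
  have h1 := (lintegral_enorm_waveExt_sq_le (measurable_freqDatum f) (integrable_freqDatum f)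
    t).trans (mul_le_mul_right (lintegral_enorm_freqDatum_sq_le f hf) _)
  rw [← halfWave_eq_waveExt, ← mul_assoc] at h1
  rw [eLpNorm_eq_lintegral_rpow_enorm_toReal (by simp) (by simp)]
  simp only [ENNReal.toReal_ofNat, ENNReal.rpow_ofNat]
  refine (ENNReal.rpow_le_rpow h1 (by norm_num)).trans_eq ?_
  rw [ENNReal.mul_rpow_of_nonneg _ _ (by norm_num), ← ENNReal.rpow_two, ← ENNReal.rpow_mul]
  norm_num

theorem exists_lintegral_eLpNorm_six_halfWave_le :
    ∃ C : ℝ≥0∞, C ≠ ⊤ ∧ ∀ f : SchwartzMap Sp ℂ, UnitFrequency f →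
      ∫⁻ t, eLpNorm (halfWave f t) 6 volume ^ 2 ≤ C * eLpNorm f 2 volume ^ 2 := by
  refine ⟨endpointConst * ENNReal.ofReal (Real.exp (4 * Real.pi)),
    ENNReal.mul_ne_top endpointConst_ne_top (by simp), fun f hf => ?_⟩
  have h0 := lintegral_enorm_freqDatum_sq_le f hf
  have h1 := (lintegral_waveExt_le (measurable_freqDatum f) (integrable_freqDatum f)
    (ne_top_of_le_ne_top (ENNReal.mul_ne_top (by simp)
      (ENNReal.pow_ne_top (f.memLp 2 volume).eLpNorm_ne_top)) h0)).trans (mul_le_mul_right h0 _)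
  rw [← halfWave_eq_waveExt, ← mul_assoc] at h1
  refine (lintegral_congr fun t => ?_).trans_le h1
  rw [eLpNorm_eq_lintegral_rpow_enorm_toReal (by simp) (by simp)]
  simp only [ENNReal.toReal_ofNat, ENNReal.rpow_ofNat]
  rw [← ENNReal.rpow_two, ← ENNReal.rpow_mul]
  norm_num

theorem holderTriple_six_fifths : ENNReal.HolderTriple (6 / 5) 6 1 where
  inv_add_inv_eq_inv := by
    have h := (ENNReal.ofReal_add (p := 5 / 6) (q := 1 / 6) (by norm_num) (by norm_num)).symm
    rw [ENNReal.ofReal_div_of_pos (by norm_num), ENNReal.ofReal_div_of_pos (by norm_num)] at h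
    rw [ENNReal.inv_div (by simp) (by simp)]
    norm_num at h ⊢
    simpa using h

theorem exists_eLpNorm_six_halfWave_le :
    ∃ C : ℝ≥0∞, C ≠ ⊤ ∧ ∀ f : SchwartzMap Sp ℂ, UnitFrequency f → ∀ t,
      eLpNorm (halfWave f t) 6 volume ≤ C * eLpNorm f 2 volume := by
  obtain ⟨A, hA, hA'⟩ := exists_eLpNorm_two_halfWave_le
  obtain ⟨B, hB, hB'⟩ := exists_eLpNorm_top_halfWave_le 2 2
  refine ⟨B ^ (2 / 3 : ℝ) * A, ENNReal.mul_ne_top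
    (ENNReal.rpow_ne_top_of_nonneg (by norm_num) hB) hA, fun f hf t => ?_⟩
  set v := halfWave f t
  have hi : eLpNorm v 6 volume ≤ eLpNorm v 2 volume ^ (1 / 3 : ℝ) *
      eLpNorm v ⊤ volume ^ (2 / 3 : ℝ) := by
    refine eLpNorm_le_rpow_mul_rpow (measurable_halfWave f t).aestronglyMeasurable (by norm_num)
      (by norm_num) (by norm_num) ?_
    rw [ENNReal.div_top, add_zero, show (2 : ℝ≥0∞) = ENNReal.ofReal 2 by simp,
      ← ENNReal.ofReal_div_of_pos (by norm_num), show (6 : ℝ≥0∞) = ENNReal.ofReal 6 by simp,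
      ← ENNReal.ofReal_inv_of_pos (by norm_num)]
    norm_num
  calc eLpNorm v 6 volume ≤ eLpNorm v 2 volume ^ (1 / 3 : ℝ) *
        (B * eLpNorm v 2 volume) ^ (2 / 3 : ℝ) := by
        refine hi.trans ?_
        gcongr
        exact hB' f hf t
    _ = B ^ (2 / 3 : ℝ) * eLpNorm v 2 volume := by
        rw [ENNReal.mul_rpow_of_nonneg _ _ (by norm_num), mul_left_comm,
          ← ENNReal.rpow_add_of_nonneg _ _ (by norm_num) (by norm_num)]
        norm_num
    _ ≤ _ := by
        rw [mul_assoc]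
        gcongr
        exact hA' f hf t

theorem toReal_inv_le_half {p : ℝ≥0∞} (hp : 2 ≤ p) : (p⁻¹).toReal ≤ 1 / 2 := by
  refine (ENNReal.toReal_mono (by simp) (ENNReal.inv_le_inv.2 hp)).trans_eq ?_
  simp

/-- Fixed-time interpolation between the energy and the `L⁶` norm. -/
theorem exists_eLpNorm_halfWave_le {r : ℝ≥0∞} (hr : 2 ≤ r) :
    ∃ θ : ℝ, 0 ≤ θ ∧ θ ≤ 1 ∧ min 1 (3 / 2 - 3 * (r⁻¹).toReal) ≤ θ ∧ ∃ C : ℝ≥0∞, C ≠ ⊤ ∧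
      ∀ f : SchwartzMap Sp ℂ, UnitFrequency f → ∀ t, eLpNorm (halfWave f t) r volume ≤
        C * eLpNorm f 2 volume ^ (1 - θ) * eLpNorm (halfWave f t) 6 volume ^ θ := by
  have hrtop : r⁻¹ ≠ ⊤ := by
    simp only [ne_eq, ENNReal.inv_eq_top]
    rintro rfl
    simp at hr
  set i : ℝ := (r⁻¹).toReal with hi
  have hi0 : 0 ≤ i := ENNReal.toReal_nonneg
  have hir : ENNReal.ofReal i = r⁻¹ := ENNReal.ofReal_toReal hrtop
  have hi2 : i ≤ 1 / 2 := toReal_inv_le_half hr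
  rcases le_total (1 / 6) i with h6 | h6
  · obtain ⟨A, hA, hA'⟩ := exists_eLpNorm_two_halfWave_le
    refine ⟨3 / 2 - 3 * i, by linarith, by linarith, min_le_right _ _,
      A ^ (1 - (3 / 2 - 3 * i)), ENNReal.rpow_ne_top_of_nonneg (by linarith) hA,
      fun f hf t => ?_⟩
    refine (eLpNorm_le_rpow_mul_rpow (a := 1 - (3 / 2 - 3 * i)) (b := 3 / 2 - 3 * i)
      (p₀ := 2) (p₁ := 6) (measurable_halfWave f t).aestronglyMeasurable
      (by linarith) (by linarith) (by ring) ?_).trans ?_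
    · rw [← hir, show (2 : ℝ≥0∞) = ENNReal.ofReal 2 by simp,
        ← ENNReal.ofReal_div_of_pos (by norm_num), show (6 : ℝ≥0∞) = ENNReal.ofReal 6 by simp,
        ← ENNReal.ofReal_div_of_pos (by norm_num), ← ENNReal.ofReal_add (by linarith) (by linarith)]
      congr 1
      ring
    · rw [← ENNReal.mul_rpow_of_nonneg _ _ (by linarith)]
      gcongr
      · linarith
      · exact hA' f hf t
  · have := holderTriple_six_fifths
    obtain ⟨B, hB, hB'⟩ := exists_eLpNorm_top_halfWave_le 6 (6 / 5)
    refine ⟨1, zero_le_one, le_rfl, min_le_left _ _, B ^ (1 - 6 * i),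
      ENNReal.rpow_ne_top_of_nonneg (by linarith) hB, fun f hf t => ?_⟩
    refine (eLpNorm_le_rpow_mul_rpow (a := 6 * i) (b := 1 - 6 * i)
      (p₀ := 6) (p₁ := ⊤) (measurable_halfWave f t).aestronglyMeasurable
      (by linarith) (by linarith) (by ring) ?_).trans ?_
    · rw [← hir, ENNReal.div_top, add_zero, show (6 : ℝ≥0∞) = ENNReal.ofReal 6 by simp,
        ← ENNReal.ofReal_div_of_pos (by norm_num)]
      congr 1
      ring
    · set U := eLpNorm (halfWave f t) 6 volume
      calc _ ≤ U ^ (6 * i) * (B * U) ^ (1 - 6 * i) := by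
            gcongr
            · linarith
            · exact hB' f hf t
        _ = _ := by
            rw [ENNReal.mul_rpow_of_nonneg _ _ (by linarith), mul_left_comm,
              ← ENNReal.rpow_add_of_nonneg _ _ (by linarith) (by linarith)]
            simp

theorem toReal_inv_add_le {q r : ℝ≥0∞} (hq : 2 ≤ q) (hr : 2 ≤ r)
    (hadm : 1/q + 3/(2*r) ≤ 3/4) : (q⁻¹).toReal + 3 / 2 * (r⁻¹).toReal ≤ 3 / 4 := by
  have hne : ∀ p : ℝ≥0∞, 2 ≤ p → p⁻¹ ≠ ⊤ := fun p hp => by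
    simp only [ne_eq, ENNReal.inv_eq_top]
    rintro rfl
    simp at hp
  have h := ENNReal.toReal_mono (ENNReal.div_ne_top (by simp) (by simp)) hadm
  rw [ENNReal.div_eq_inv_mul, mul_one, ENNReal.div_eq_inv_mul (a := 3) (b := 2 * r),
    ENNReal.mul_inv (by simp) (by simp), ENNReal.toReal_add (hne q hq)
      (ENNReal.mul_ne_top (ENNReal.mul_ne_top (by simp) (hne r hr)) (by simp))] at h
  simp only [ENNReal.toReal_mul, ENNReal.toReal_div, ENNReal.toReal_ofNat, ENNReal.toReal_inv] at h ⊢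
  linarith

/-- Fixed-time interpolation adapted to an admissible pair. -/
theorem exists_eLpNorm_halfWave_le_of_admissible {q r : ℝ≥0∞} (hq : 2 ≤ q) (hr : 2 ≤ r)
    (hadm : 1/q + 3/(2*r) ≤ 3/4) :
    ∃ C : ℝ≥0∞, C ≠ ⊤ ∧ ∀ f : SchwartzMap Sp ℂ, UnitFrequency f → ∀ t,
      eLpNorm (halfWave f t) r volume ≤ C * eLpNorm f 2 volume ^ (1 - 2 * (q⁻¹).toReal) *
        eLpNorm (halfWave f t) 6 volume ^ (2 * (q⁻¹).toReal) := by
  obtain ⟨θ, h0, h1, hmin, K, hK, hK'⟩ := exists_eLpNorm_halfWave_le hr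
  obtain ⟨A, hA, hA'⟩ := exists_eLpNorm_six_halfWave_le
  have hj := toReal_inv_add_le hq hr hadm
  have hj2 := toReal_inv_le_half hq
  have hj0 : 0 ≤ (q⁻¹).toReal := ENNReal.toReal_nonneg
  set a := 2 * (q⁻¹).toReal
  have ha : a ≤ θ := (le_min (by linarith) (by linarith)).trans hmin
  refine ⟨K * A ^ (θ - a), ENNReal.mul_ne_top hK
    (ENNReal.rpow_ne_top_of_nonneg (by linarith) hA), fun f hf t => ?_⟩
  refine (hK' f hf t).trans ?_
  set M := eLpNorm f 2 volume
  set U := eLpNorm (halfWave f t) 6 volume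
  calc K * M ^ (1 - θ) * U ^ θ = K * M ^ (1 - θ) * (U ^ (θ - a) * U ^ a) := by
        rw [← ENNReal.rpow_add_of_nonneg _ _ (by linarith) (by linarith), sub_add_cancel]
    _ ≤ K * M ^ (1 - θ) * ((A * M) ^ (θ - a) * U ^ a) := by
        gcongr
        exact hA' f hf t
    _ = K * A ^ (θ - a) * (M ^ (1 - θ) * M ^ (θ - a)) * U ^ a := by
        rw [ENNReal.mul_rpow_of_nonneg _ _ (by linarith)]
        ring
    _ = _ := by
        rw [← ENNReal.rpow_add_of_nonneg _ _ (by linarith) (by linarith)]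
        congr 3
        ring

theorem exists_LqLr_halfWave_le {q r : ℝ≥0∞} (hq : 2 ≤ q) (hr : 2 ≤ r)
    (hadm : 1/q + 3/(2*r) ≤ 3/4) :
    ∃ C : ℝ≥0∞, C ≠ ⊤ ∧ ∀ f : SchwartzMap Sp ℂ, UnitFrequency f →
      LqLr q r (halfWave f) ≤ C * eLpNorm f 2 volume := by
  obtain ⟨K, hK, hK'⟩ := exists_eLpNorm_halfWave_le_of_admissible hq hr hadm
  have henorm (x : ℝ≥0∞) : ‖x.toReal‖ₑ ≤ x := by
    rw [Real.enorm_of_nonneg ENNReal.toReal_nonneg]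
    exact ENNReal.ofReal_toReal_le
  by_cases hqt : q = ⊤
  · subst hqt
    refine ⟨K, hK, fun f hf => ?_⟩
    rw [LqLr, eLpNorm_exponent_top]
    refine eLpNormEssSup_le_of_ae_enorm_bound (Filter.Eventually.of_forall fun t => ?_)
    refine (henorm _).trans ((hK' f hf t).trans_eq ?_)
    simp
  obtain ⟨B, hB, hB'⟩ := exists_lintegral_eLpNorm_six_halfWave_le
  have hq0 : q ≠ 0 := by
    rintro rfl
    simp at hq
  have hk : 0 < q.toReal := ENNReal.toReal_pos hq0 hqt
  have hj2 := toReal_inv_le_half hq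
  rw [ENNReal.toReal_inv] at hK' hj2
  set k := q.toReal with hkdef
  refine ⟨K * B ^ k⁻¹, ENNReal.mul_ne_top hK
    (ENNReal.rpow_ne_top_of_nonneg (by positivity) hB), fun f hf => ?_⟩
  set M := eLpNorm f 2 volume with hM
  have hMt : M ≠ ⊤ := (f.memLp 2 volume).eLpNorm_ne_top
  have hc : K * M ^ (1 - 2 * k⁻¹) ≠ ⊤ :=
    ENNReal.mul_ne_top hK (ENNReal.rpow_ne_top_of_nonneg (by linarith) hMt)
  have hint : ∫⁻ t, ‖(eLpNorm (halfWave f t) r volume).toReal‖ₑ ^ k ≤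
      (K * M ^ (1 - 2 * k⁻¹)) ^ k * (B * M ^ 2) := by
    refine le_trans ?_ (mul_le_mul_right (hB' f hf) _)
    rw [← lintegral_const_mul' _ _ (ENNReal.rpow_ne_top_of_nonneg hk.le hc)]
    refine lintegral_mono fun t => ?_
    refine (ENNReal.rpow_le_rpow ((henorm _).trans (hK' f hf t)) hk.le).trans_eq ?_
    rw [ENNReal.mul_rpow_of_nonneg _ _ hk.le, ← ENNReal.rpow_mul, mul_assoc 2,
      inv_mul_cancel₀ hk.ne', mul_one, ENNReal.rpow_two]
  rw [LqLr, eLpNorm_eq_lintegral_rpow_enorm_toReal hq0 hqt, ← hkdef, one_div]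
  refine (ENNReal.rpow_le_rpow hint (by positivity)).trans_eq ?_
  rw [ENNReal.mul_rpow_of_nonneg _ _ (by positivity), ENNReal.rpow_rpow_inv hk.ne',
    ENNReal.mul_rpow_of_nonneg _ _ (by positivity), ← ENNReal.rpow_two, ← ENNReal.rpow_mul,
    show ∀ x y z w : ℝ≥0∞, x * y * (z * w) = x * z * (y * w) by intros; ring,
    ← ENNReal.rpow_add_of_nonneg _ _ (by linarith) (by positivity), sub_add_cancel,
    ENNReal.rpow_one]

end strichartz

/-- (Classical Strichartz estimates on `ℝ^{4+1}`, including endpoints.)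
For every unit-frequency Schwartz function `f : ℝ⁴ → ℂ` and `u(t,x) = e^{it√(−Δ)}f(x)`,
and all exponents `q, r ∈ [2,∞]` with `1/q + 3/(2r) ≤ 3/4`, one has
`‖u‖_{L^q_t L^r_x} ≤ C_{q,r} ‖f‖_{L²(ℝ⁴)}` with a constant independent of `f`. -/
theorem statement6 (q r : ℝ≥0∞) (hq : 2 ≤ q) (hr : 2 ≤ r)
    (hadm : 1/q + 3/(2*r) ≤ 3/4) :
    ∃ C : ℝ, 0 < C ∧ ∀ f : SchwartzMap Sp ℂ, UnitFrequency f →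
      LqLr q r (halfWave f) ≤ ENNReal.ofReal C * eLpNorm (⇑f) 2 volume := by
  obtain ⟨K, hK, hK'⟩ := exists_LqLr_halfWave_le hq hr hadm
  refine ⟨K.toReal + 1, by positivity, fun f hf => (hK' f hf).trans ?_⟩
  gcongr
  exact ENNReal.le_ofReal_iff_toReal_le hK (by positivity) |>.2 (by linarith)

end
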